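/- arXiv:1105.5066 — 2 statements merged into one kernel-verified Lean document; each statement's English description precedes it below -/
import Mathlib

section
/- (Infinitesimal metric rigidity of convex spherical polyhedra.) Let V ⊂ S³ = {x ∈ ℝ⁴ : ‖x‖ = 1} be a finite set, let C ⊆ ℝ⁴ be the closed convex cone generated by V, and assume: C has nonempty interior; C is pointed (C ∩ (−C) = {0}); every v ∈ V spans an extreme ray of C and distinct elements of V span distinct rays; and C is simplicial, i.e., every exposed face G of C with dim span(G) = 3 contains exactly three elements of V. Call {v, w} an edge if the cone generated by {v, w} is an exposed face G of C with dim span(G) = 2. If q : V → ℝ⁴ satisfies ⟨v, q(v)⟩ = 0 for every v ∈ V and ⟨q(v), w⟩ + ⟨v, q(w)⟩ = 0 for every edge {v, w} (the geodesic edge lengths arccos⟨v, w⟩ are constant in the first order), then there exists a skew-symmetric linear map A : ℝ⁴ → ℝ⁴ (Aᵀ = −A) with q(v) = A(v) for every v ∈ V (the deformation is the restriction of an infinitesimal rotation, i.e., the polyhedron is congruent to itself in the first order). -/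
open scoped RealInnerProductSpace

/-- The determinant of four vectors of `ℝ⁴`. -/
noncomputable def det4 (a b c d : EuclideanSpace ℝ (Fin 4)) : ℝ :=
  Matrix.det !![a 0, a 1, a 2, a 3; b 0, b 1, b 2, b 3; c 0, c 1, c 2, c 3; d 0, d 1, d 2, d 3]

lemma det4_eq (a b c d : EuclideanSpace ℝ (Fin 4)) :
    det4 a b c d =
      (a 0 * b 1 - a 1 * b 0) * (c 2 * d 3 - c 3 * d 2)
      - (a 0 * b 2 - a 2 * b 0) * (c 1 * d 3 - c 3 * d 1)
      + (a 0 * b 3 - a 3 * b 0) * (c 1 * d 2 - c 2 * d 1)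
      + (a 1 * b 2 - a 2 * b 1) * (c 0 * d 3 - c 3 * d 0)
      - (a 1 * b 3 - a 3 * b 1) * (c 0 * d 2 - c 2 * d 0)
      + (a 2 * b 3 - a 3 * b 2) * (c 0 * d 1 - c 1 * d 0) := by
  simp [det4, Matrix.det_succ_row_zero, Fin.sum_univ_succ, Fin.succAbove]
  ring

lemma det4_swap12 (a b c d : EuclideanSpace ℝ (Fin 4)) : det4 b a c d = -det4 a b c d := by
  simp only [det4_eq]; ring

lemma det4_swap23 (a b c d : EuclideanSpace ℝ (Fin 4)) : det4 a c b d = -det4 a b c d := by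
  simp only [det4_eq]; ring

lemma det4_swap34 (a b c d : EuclideanSpace ℝ (Fin 4)) : det4 a b d c = -det4 a b c d := by
  simp only [det4_eq]; ring

lemma det4_rotate (a b c d : EuclideanSpace ℝ (Fin 4)) : det4 b c a d = det4 a b c d := by
  simp only [det4_eq]; ring

/-- The determinant as a linear form in its last argument. -/
noncomputable def det4Linear (a b c : EuclideanSpace ℝ (Fin 4)) :
    EuclideanSpace ℝ (Fin 4) →ₗ[ℝ] ℝ where
  toFun := det4 a b c
  map_add' x y := by simp only [det4_eq, PiLp.add_apply]; ring
  map_smul' t x := by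
    simp only [det4_eq, PiLp.smul_apply, smul_eq_mul, RingHom.id_apply]; ring

@[simp] lemma det4Linear_apply (a b c d : EuclideanSpace ℝ (Fin 4)) :
    det4Linear a b c d = det4 a b c d := rfl

/-- The Cramer rule. -/
lemma det4_smul (a b c d x : EuclideanSpace ℝ (Fin 4)) :
    det4 a b c d • x =
      det4 x b c d • a + det4 a x c d • b + det4 a b x d • c + det4 a b c x • d := by
  ext i
  fin_cases i <;> simp [det4_eq] <;> ring

lemma det4_self_left (a c d : EuclideanSpace ℝ (Fin 4)) : det4 a a c d = 0 := by
  simp only [det4_eq]; ring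
lemma det4_self_mid (a b d : EuclideanSpace ℝ (Fin 4)) : det4 a b b d = 0 := by
  simp only [det4_eq]; ring
lemma det4_self_right (a b c : EuclideanSpace ℝ (Fin 4)) : det4 a b c c = 0 := by
  simp only [det4_eq]; ring
lemma det4_self_outer (a b c : EuclideanSpace ℝ (Fin 4)) : det4 a b c a = 0 := by
  simp only [det4_eq]; ring
lemma det4_self_one_three (a b d : EuclideanSpace ℝ (Fin 4)) : det4 a b a d = 0 := by
  simp only [det4_eq]; ring
lemma det4_self_two_four (a b c : EuclideanSpace ℝ (Fin 4)) : det4 a b c b = 0 := by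
  simp only [det4_eq]; ring

lemma eq_zero_of_inner_eq_zero {a b c d z : EuclideanSpace ℝ (Fin 4)} (h : det4 a b c d ≠ 0)
    (ha : ⟪z, a⟫ = 0) (hb : ⟪z, b⟫ = 0) (hc : ⟪z, c⟫ = 0) (hd : ⟪z, d⟫ = 0) : z = 0 := by
  have := congrArg (fun y => ⟪z, y⟫) (det4_smul a b c d z)
  simp only [inner_add_right, inner_smul_right, ha, hb, hc, hd, mul_zero, add_zero] at this
  exact inner_self_eq_zero.1 ((mul_eq_zero.1 this).resolve_left h)

/-- The three-term Plücker relation. -/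
lemma det4_mul_det4 (v w a b x y : EuclideanSpace ℝ (Fin 4)) :
    det4 v w a b * det4 v w x y =
      det4 v w x b * det4 v w a y + det4 v w a x * det4 v w b y := by
  have := congrArg (det4Linear v w y) (det4_smul v w a b x)
  simp only [map_add, map_smul, det4Linear_apply, smul_eq_mul, det4_self_outer,
    det4_self_two_four] at this
  rw [det4_swap34 v w x y, det4_swap34 v w a y, det4_swap34 v w b y] at this
  linarith

/-- Skew-symmetric endomorphisms. -/
def IsSkew (A : EuclideanSpace ℝ (Fin 4) →ₗ[ℝ] EuclideanSpace ℝ (Fin 4)) : Prop :=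
  ∀ x y, ⟪A x, y⟫ = -⟪x, A y⟫

lemma IsSkew.sub {A B : EuclideanSpace ℝ (Fin 4) →ₗ[ℝ] EuclideanSpace ℝ (Fin 4)}
    (hA : IsSkew A) (hB : IsSkew B) : IsSkew (A - B) := fun x y => by
  simp only [LinearMap.sub_apply, inner_sub_left, inner_sub_right, hA x y, hB x y]; ring

lemma IsSkew.inner_self {A : EuclideanSpace ℝ (Fin 4) →ₗ[ℝ] EuclideanSpace ℝ (Fin 4)}
    (hA : IsSkew A) (x : EuclideanSpace ℝ (Fin 4)) : ⟪A x, x⟫ = 0 := by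
  have := hA x x
  rw [real_inner_comm x (A x)] at this ⊢
  linarith

/-- A skew map vanishing on a plane is a multiple of the infinitesimal rotation about it. -/
lemma IsSkew.exists_eq_mul_det4
    {S : EuclideanSpace ℝ (Fin 4) →ₗ[ℝ] EuclideanSpace ℝ (Fin 4)} (hS : IsSkew S)
    {v w a b : EuclideanSpace ℝ (Fin 4)} (h : det4 v w a b ≠ 0) (hv : S v = 0) (hw : S w = 0) :
    ∃ l : ℝ, ∀ x y, ⟪S x, y⟫ = l * det4 v w x y := by
  have expand (x : EuclideanSpace ℝ (Fin 4)) :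
      det4 v w a b • S x = det4 v w x b • S a + det4 v w a x • S b := by
    have := congrArg S (det4_smul v w a b x)
    simpa only [map_add, map_smul, hv, hw, smul_zero, zero_add] using this
  have hexp (x y : EuclideanSpace ℝ (Fin 4)) : det4 v w a b * ⟪S x, y⟫ =
      det4 v w x b * ⟪S a, y⟫ + det4 v w a x * ⟪S b, y⟫ := by
    have := congrArg (fun z => ⟪z, y⟫) (expand x)
    simpa only [inner_add_left, real_inner_smul_left] using this
  refine ⟨⟪S a, b⟫ / det4 v w a b, fun x y => ?_⟩
  have hx := hexp x y
  have ha : det4 v w a b * ⟪S a, y⟫ = det4 v w a y * ⟪S a, b⟫ := by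
    have := hexp y a
    rw [hS y a, hS.inner_self, hS b a, real_inner_comm (S a) y, real_inner_comm (S a) b] at this
    linarith
  have hb : det4 v w a b * ⟪S b, y⟫ = det4 v w b y * ⟪S a, b⟫ := by
    have := hexp y b
    rw [hS y b, hS.inner_self, real_inner_comm (S b) y, det4_swap34 v w b y] at this
    linarith
  have key : det4 v w a b * (det4 v w a b * ⟪S x, y⟫) =
      det4 v w a b * (det4 v w x y * ⟪S a, b⟫) := by
    rw [hx]
    linear_combination det4 v w x b * ha + det4 v w a x * hb
      - ⟪S a, b⟫ * det4_mul_det4 v w a b x y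
  have := mul_left_cancel₀ h key
  rw [div_mul_eq_mul_div, eq_div_iff h]
  linarith

lemma IsSkew.eq_of_eq_on
    {A B : EuclideanSpace ℝ (Fin 4) →ₗ[ℝ] EuclideanSpace ℝ (Fin 4)}
    (hA : IsSkew A) (hB : IsSkew B) {u v w x : EuclideanSpace ℝ (Fin 4)}
    (h : det4 u v w x ≠ 0) (hu : A u = B u) (hv : A v = B v) (hw : A w = B w) : A = B := by
  have hS := hA.sub hB
  obtain ⟨l, hl⟩ := hS.exists_eq_mul_det4 h (by simp [hu]) (by simp [hv])
  have h0 := hl w x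
  rw [LinearMap.sub_apply, hw, sub_self, inner_zero_left] at h0
  have hl0 : l = 0 := (mul_eq_zero.1 h0.symm).resolve_right h
  refine sub_eq_zero.1 (LinearMap.ext fun y => ?_)
  exact ext_inner_right ℝ fun z => by rw [hl y z, hl0]; simp

lemma exists_inner_eq_det4 (a b c : EuclideanSpace ℝ (Fin 4)) :
    ∃ n : EuclideanSpace ℝ (Fin 4), ∀ x, ⟪n, x⟫ = det4 a b c x :=
  ⟨(InnerProductSpace.toDual ℝ _).symm (det4Linear a b c).toContinuousLinearMap, fun x => by
    rw [InnerProductSpace.toDual_symm_apply]; rfl⟩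

/-- First-order isometric velocities on a triangle are induced by a skew map. -/
lemma exists_isSkew {u v w x : EuclideanSpace ℝ (Fin 4)} (h : det4 u v w x ≠ 0)
    {q : EuclideanSpace ℝ (Fin 4) → EuclideanSpace ℝ (Fin 4)}
    (hu : ⟪u, q u⟫ = 0) (hv : ⟪v, q v⟫ = 0) (hw : ⟪w, q w⟫ = 0)
    (huv : ⟪q u, v⟫ + ⟪u, q v⟫ = 0) (hvw : ⟪q v, w⟫ + ⟪v, q w⟫ = 0)
    (hwu : ⟪q w, u⟫ + ⟪w, q u⟫ = 0) :
    ∃ A, IsSkew A ∧ A u = q u ∧ A v = q v ∧ A w = q w := by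
  obtain ⟨n, hn⟩ := exists_inner_eq_det4 u v w
  have hD : det4 u v w n ≠ 0 := by
    rw [← hn, Ne, inner_self_eq_zero]
    rintro rfl
    exact h (by rw [← hn, inner_zero_left])
  -- `B` sends `u, v, w` to their velocities and kills `n`
  let B : EuclideanSpace ℝ (Fin 4) →ₗ[ℝ] EuclideanSpace ℝ (Fin 4) :=
    (det4 u v w n)⁻¹ • ((-det4Linear v w n).smulRight (q u) + (det4Linear u w n).smulRight (q v)
      + (-det4Linear u v n).smulRight (q w))
  have hB (x) : det4 u v w n • B x =
      det4 x v w n • q u + det4 u x w n • q v + det4 u v x n • q w := by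
    have h1 : -det4 v w n x = det4 x v w n := by simp only [det4_eq]; ring
    have h2 : det4 u w n x = det4 u x w n := by simp only [det4_eq]; ring
    have h3 : -det4 u v n x = det4 u v x n := by simp only [det4_eq]; ring
    simp only [B, LinearMap.smul_apply, LinearMap.add_apply, LinearMap.smulRight_apply,
      LinearMap.neg_apply, det4Linear_apply, h1, h2, h3, smul_smul, mul_inv_cancel₀ hD, one_smul]
  obtain ⟨k, hk⟩ : ∃ k, ∀ x, det4 u v w n * ⟪k, x⟫ = ⟪n, B x⟫ :=
    ⟨(det4 u v w n)⁻¹ • LinearMap.adjoint B n, fun x => by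
      rw [real_inner_smul_left, LinearMap.adjoint_inner_left, mul_inv_cancel_left₀ hD]⟩
  let A := B - (det4Linear u v w).smulRight k
  have hA (x) : A x = B x - det4 u v w x • k := rfl
  have hAself (x) : ⟪A x, x⟫ = 0 := by
    have hx := det4_smul u v w n x
    have e1 : det4 u v w n * (det4 u v w n * ⟪A x, x⟫) =
        ⟪det4 u v w n • B x, det4 u v w n • x - det4 u v w x • n⟫ := by
      simp only [hA, inner_sub_left, inner_sub_right, inner_smul_right, real_inner_smul_left]
      rw [real_inner_comm n (B x)]
      linear_combination (-det4 u v w n * det4 u v w x) * hk x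
    have e2 : det4 u v w n • x - det4 u v w x • n =
        det4 x v w n • u + det4 u x w n • v + det4 u v x n • w := by
      rw [hx]; abel
    rw [e2, hB] at e1
    have e3 : ⟪det4 x v w n • q u + det4 u x w n • q v + det4 u v x n • q w,
        det4 x v w n • u + det4 u x w n • v + det4 u v x n • w⟫ = 0 := by
      simp only [inner_add_left, inner_add_right, real_inner_smul_left, inner_smul_right]
      rw [real_inner_comm u (q u), real_inner_comm v (q v), real_inner_comm w (q w),
        real_inner_comm u (q v), real_inner_comm v (q w), real_inner_comm w (q u)]
      linear_combination (det4 x v w n) ^ 2 * hu + (det4 u x w n) ^ 2 * hv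
        + (det4 u v x n) ^ 2 * hw + det4 x v w n * det4 u x w n * huv
        + det4 u x w n * det4 u v x n * hvw + det4 x v w n * det4 u v x n * hwu
    rw [e3] at e1
    simpa [hD] using e1
  refine ⟨A, fun x y => ?_, ?_, ?_, ?_⟩
  · have := hAself (x + y)
    rw [map_add, inner_add_left, inner_add_right, inner_add_right, hAself, hAself,
      real_inner_comm x (A y)] at this
    linarith
  · refine smul_right_injective _ hD ?_
    simp [hA, hB, det4_self_outer, det4_self_left, det4_self_one_three]
  · refine smul_right_injective _ hD ?_
    simp [hA, hB, det4_self_two_four, det4_self_left, det4_self_mid]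
  · refine smul_right_injective _ hD ?_
    simp [hA, hB, det4_self_right, det4_self_one_three, det4_self_mid]

/-- `v, w, a` span, in positive order, a facet of the cone over `V` containing no other point
of `V`. -/
def PosFacet (V : Finset (EuclideanSpace ℝ (Fin 4))) (v w a : EuclideanSpace ℝ (Fin 4)) : Prop :=
  v ∈ V ∧ w ∈ V ∧ a ∈ V ∧ (∃ x ∈ V, 0 < det4 v w a x) ∧
    ∀ x ∈ V, x = v ∨ x = w ∨ x = a ∨ 0 < det4 v w a x

/-- `v, w` are two vertices of a triangular facet, in positive order. -/
def IsEdge (V : Finset (EuclideanSpace ℝ (Fin 4))) (v w : EuclideanSpace ℝ (Fin 4)) : Prop :=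
  ∃ a, PosFacet V v w a

section Facets

variable {V : Finset (EuclideanSpace ℝ (Fin 4))} {v w a b x : EuclideanSpace ℝ (Fin 4)}

lemma PosFacet.rotate (h : PosFacet V v w a) : PosFacet V w a v := by
  obtain ⟨hv, hw, ha, ⟨x, hx, hpos⟩, hall⟩ := h
  refine ⟨hw, ha, hv, ⟨x, hx, by rwa [det4_rotate]⟩, fun y hy => ?_⟩
  rw [det4_rotate]
  have := hall y hy
  tauto

lemma PosFacet.pos_of_ne (h : PosFacet V v w a) (hx : x ∈ V) (hv : x ≠ v) (hw : x ≠ w)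
    (ha : x ≠ a) : 0 < det4 v w a x := by
  have := h.2.2.2.2 x hx
  tauto

lemma PosFacet.ne (h : PosFacet V v w a) : v ≠ w := by
  rintro rfl
  obtain ⟨x, -, hx⟩ := h.2.2.2.1
  simp [det4_self_left] at hx

lemma PosFacet.unique (h : PosFacet V v w a) (h' : PosFacet V v w b) : a = b := by
  by_contra hab
  have h1 := h.pos_of_ne h'.2.2.1 h'.rotate.rotate.ne h'.rotate.ne.symm (Ne.symm hab)
  have h2 := h'.pos_of_ne h.2.2.1 h.rotate.rotate.ne h.rotate.ne.symm hab
  rw [det4_swap34] at h2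
  linarith

lemma IsEdge.left_mem (h : IsEdge V v w) : v ∈ V := h.choose_spec.1

lemma IsEdge.right_mem (h : IsEdge V v w) : w ∈ V := h.choose_spec.2.1

lemma IsEdge.ne (h : IsEdge V v w) : v ≠ w := h.choose_spec.ne

open Classical in
/-- The vertices adjacent to `v`. -/
noncomputable def neighbors (V : Finset (EuclideanSpace ℝ (Fin 4)))
    (v : EuclideanSpace ℝ (Fin 4)) : Finset (EuclideanSpace ℝ (Fin 4)) :=
  V.filter (IsEdge V v)

lemma mem_neighbors : w ∈ neighbors V v ↔ IsEdge V v w := by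
  simp only [neighbors, Finset.mem_filter, and_iff_right_iff_imp]
  exact IsEdge.right_mem

open Classical in
/-- The third vertex of the positive facet through the edge `v, w`. -/
noncomputable def thirdVertex (V : Finset (EuclideanSpace ℝ (Fin 4)))
    (v w : EuclideanSpace ℝ (Fin 4)) : EuclideanSpace ℝ (Fin 4) :=
  if h : IsEdge V v w then h.choose else 0

lemma IsEdge.posFacet_third (h : IsEdge V v w) : PosFacet V v w (thirdVertex V v w) := by
  rw [thirdVertex, dif_pos h]
  exact h.choose_spec

lemma sum_third (hsymm : ∀ v w, IsEdge V v w → IsEdge V w v) (f : EuclideanSpace ℝ (Fin 4) → ℝ) :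
    ∑ w ∈ neighbors V v, f (thirdVertex V v w) = ∑ w ∈ neighbors V v, f w := by
  refine Finset.sum_bij (fun w _ => thirdVertex V v w) ?_ ?_ ?_ fun _ _ => rfl
  · intro w hw
    rw [mem_neighbors] at hw ⊢
    exact hsymm _ _ ⟨w, hw.posFacet_third.rotate.rotate⟩
  · intro w hw w' hw' h
    rw [mem_neighbors] at hw hw'
    have h1 := hw.posFacet_third.rotate.rotate
    rw [h] at h1
    exact h1.unique hw'.posFacet_third.rotate.rotate
  · intro a ha
    rw [mem_neighbors] at ha
    obtain ⟨w, hw⟩ := hsymm _ _ ha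
    have hvw : IsEdge V v w := ⟨a, hw.rotate⟩
    exact ⟨w, mem_neighbors.2 hvw, hvw.posFacet_third.unique hw.rotate⟩

/-- `B v w` is an infinitesimal rotation inducing `q` on the positive facet through `v, w`. -/
structure IsFacetRotation (V : Finset (EuclideanSpace ℝ (Fin 4)))
    (q : EuclideanSpace ℝ (Fin 4) → EuclideanSpace ℝ (Fin 4))
    (B : EuclideanSpace ℝ (Fin 4) → EuclideanSpace ℝ (Fin 4) →
      EuclideanSpace ℝ (Fin 4) →ₗ[ℝ] EuclideanSpace ℝ (Fin 4)) : Prop where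
  skew : ∀ v w, IsEdge V v w → IsSkew (B v w)
  left : ∀ v w, IsEdge V v w → B v w v = q v
  right : ∀ v w, IsEdge V v w → B v w w = q w
  third : ∀ v w a, PosFacet V v w a → B v w a = q a

variable {q : EuclideanSpace ℝ (Fin 4) → EuclideanSpace ℝ (Fin 4)}
  {B : EuclideanSpace ℝ (Fin 4) → EuclideanSpace ℝ (Fin 4) →
    EuclideanSpace ℝ (Fin 4) →ₗ[ℝ] EuclideanSpace ℝ (Fin 4)}

lemma IsFacetRotation.rotate (hB : IsFacetRotation V q B) (h : PosFacet V v w a) :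
    B w a = B v w := by
  have e : IsEdge V v w := ⟨a, h⟩
  have e' : IsEdge V w a := ⟨v, h.rotate⟩
  obtain ⟨x, -, hx⟩ := h.2.2.2.1
  refine (hB.skew _ _ e').eq_of_eq_on (hB.skew _ _ e) hx.ne' ?_ ?_ ?_
  · rw [hB.left _ _ e, hB.third _ _ _ h.rotate]
  · rw [hB.right _ _ e, hB.left _ _ e']
  · rw [hB.right _ _ e', hB.third _ _ _ h]

/-- The rotations of two adjacent facets differ by a rotation about their common edge; the
coefficients are symmetric in the edge. -/
lemma IsFacetRotation.exists_stress (hB : IsFacetRotation V q B)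
    (hsymm : ∀ v w, IsEdge V v w → IsEdge V w v) :
    ∃ l : EuclideanSpace ℝ (Fin 4) → EuclideanSpace ℝ (Fin 4) → ℝ,
      (∀ v w, l v w = l w v) ∧ (∀ v w, ¬ IsEdge V v w → l v w = 0) ∧
      ∀ v w, IsEdge V v w → ∀ x y, ⟪(B v w - B w v) x, y⟫ = l v w * det4 v w x y := by
  classical
  have key (v w) (h : IsEdge V v w) :
      ∃ l : ℝ, ∀ x y, ⟪(B v w - B w v) x, y⟫ = l * det4 v w x y := by
    obtain ⟨a, ha⟩ := h
    obtain ⟨x, -, hx⟩ := ha.2.2.2.1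
    have h : IsEdge V v w := ⟨a, ha⟩
    have h' := hsymm _ _ h
    refine ((hB.skew _ _ h).sub (hB.skew _ _ h')).exists_eq_mul_det4 hx.ne' ?_ ?_
    · rw [LinearMap.sub_apply, hB.left _ _ h, hB.right _ _ h', sub_self]
    · rw [LinearMap.sub_apply, hB.left _ _ h', hB.right _ _ h, sub_self]
  let l v w := if h : IsEdge V v w then (key v w h).choose else 0
  have hl (v w) (h : IsEdge V v w) (x y) :
      ⟪(B v w - B w v) x, y⟫ = l v w * det4 v w x y := by
    simp only [l, dif_pos h]
    exact (key v w h).choose_spec x y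
  refine ⟨l, fun v w => ?_, fun v w h => dif_neg h, hl⟩
  by_cases h : IsEdge V v w
  · have h' := hsymm _ _ h
    obtain ⟨a, ha⟩ := id h
    obtain ⟨x, -, hx⟩ := ha.2.2.2.1
    have h1 := hl v w h a x
    have h2 := hl w v h' a x
    rw [← neg_sub, LinearMap.neg_apply, inner_neg_left, h1, det4_swap12 v w] at h2
    have : l v w * det4 v w a x = l w v * det4 v w a x := by linarith
    exact mul_right_cancel₀ hx.ne' this
  · have h' : ¬ IsEdge V w v := fun h' => h (hsymm _ _ h')
    simp only [l, dif_neg h, dif_neg h']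

lemma sum_neighbors {l : EuclideanSpace ℝ (Fin 4) → EuclideanSpace ℝ (Fin 4) → ℝ}
    (hl : ∀ v w, ¬ IsEdge V v w → l v w = 0) (f : EuclideanSpace ℝ (Fin 4) → ℝ) :
    ∑ w ∈ V, l v w * f w = ∑ w ∈ neighbors V v, l v w * f w := by
  rw [neighbors, Finset.sum_filter]
  refine Finset.sum_congr rfl fun w _ => ?_
  split_ifs with h
  · rfl
  · rw [hl _ _ h, zero_mul]

/-- The coefficients of a facet rotation are in equilibrium at every vertex. -/
lemma IsFacetRotation.exists_equilibrium (hB : IsFacetRotation V q B)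
    (hsymm : ∀ v w, IsEdge V v w → IsEdge V w v)
    {l : EuclideanSpace ℝ (Fin 4) → EuclideanSpace ℝ (Fin 4) → ℝ}
    (hl0 : ∀ v w, ¬ IsEdge V v w → l v w = 0)
    (hl : ∀ v w, IsEdge V v w → ∀ x y, ⟪(B v w - B w v) x, y⟫ = l v w * det4 v w x y)
    (hne : ∃ w, IsEdge V v w) :
    ∃ m : ℝ, ∑ w ∈ V, l v w • w + m • v = 0 := by
  set z := ∑ w ∈ V, l v w • w with hz
  have hdet (x y) : det4 v z x y = 0 := by
    have hcyc (t) : det4 v t x y = det4Linear v x y t := by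
      simp only [det4Linear_apply, det4_eq]; ring
    rw [hcyc, hz, map_sum]
    simp only [map_smul, smul_eq_mul]
    simp only [← hcyc]
    rw [sum_neighbors hl0 (fun w => det4 v w x y)]
    have h1 : ∀ w ∈ neighbors V v, l v w * det4 v w x y = ⟪B v w x, y⟫ - ⟪B w v x, y⟫ := by
      intro w hw
      rw [← hl v w (mem_neighbors.1 hw), LinearMap.sub_apply, inner_sub_left]
    rw [Finset.sum_congr rfl h1, Finset.sum_sub_distrib,
      ← sum_third hsymm (fun w => ⟪B w v x, y⟫), sub_eq_zero]
    refine Finset.sum_congr rfl fun w hw => ?_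
    have hf := (mem_neighbors.1 hw).posFacet_third
    rw [← hB.rotate hf.rotate.rotate]
  obtain ⟨w, a, hw⟩ := hne
  obtain ⟨x, -, hx⟩ := hw.2.2.2.1
  have hc := det4_smul v w a x z
  have h1 : det4 v w z x = 0 := by rw [det4_swap23 v z w x, hdet, neg_zero]
  have h2 : det4 v w a z = 0 := by
    rw [det4_swap34 v w z a, det4_swap23 v z w a, hdet, neg_zero, neg_zero]
  rw [hdet, h1, h2, zero_smul, zero_smul, zero_smul, add_zero, add_zero, add_zero] at hc
  refine ⟨-(det4 z w a x / det4 v w a x), smul_right_injective _ hx.ne' ?_⟩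
  simp only [smul_add, hc, smul_smul, smul_zero]
  rw [mul_neg, mul_div_cancel₀ _ hx.ne', neg_smul, add_neg_cancel]

/-- The decisive inequality at a vertex: the quadratic form of an equilibrium stress on the
link of `v` is semidefinite. -/
lemma IsFacetRotation.inner_stress_nonpos (hB : IsFacetRotation V q B)
    (hsymm : ∀ v w, IsEdge V v w → IsEdge V w v)
    {l : EuclideanSpace ℝ (Fin 4) → EuclideanSpace ℝ (Fin 4) → ℝ}
    (hl0 : ∀ v w, ¬ IsEdge V v w → l v w = 0)
    (hl : ∀ v w, IsEdge V v w → ∀ x y, ⟪(B v w - B w v) x, y⟫ = l v w * det4 v w x y)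
    {m : ℝ} (hm : ∑ w ∈ V, l v w • w + m • v = 0) {u y : EuclideanSpace ℝ (Fin 4)}
    (hu : IsEdge V v u) (hy : ∀ w, IsEdge V v w → w ≠ u → 0 < det4 v u w y) :
    ⟪u, ∑ w ∈ V, l v w • q w + m • q v⟫ ≤ 0 ∧
      (⟪u, ∑ w ∈ V, l v w • q w + m • q v⟫ = 0 →
        ∀ w, IsEdge V v w → ⟪(B v w - B v u) u, y⟫ = 0) := by
  set S : EuclideanSpace ℝ (Fin 4) → EuclideanSpace ℝ (Fin 4) →ₗ[ℝ] EuclideanSpace ℝ (Fin 4) :=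
    fun w => B v w - B v u with hS
  set g : EuclideanSpace ℝ (Fin 4) → ℝ := fun w => ⟪u, q w - B v u w⟫ / det4 v u w y with hg
  have e1 : ⟪u, ∑ w ∈ V, l v w • q w + m • q v⟫ = ∑ w ∈ V, l v w * ⟪u, q w - B v u w⟫ := by
    have := congrArg (fun z => ⟪u, B v u z⟫) hm
    simp only [map_add, map_sum, map_smul, map_zero, inner_add_right, inner_sum,
      inner_smul_right, inner_zero_right, hB.left _ _ hu] at this
    simp only [inner_add_right, inner_sum, inner_smul_right, inner_sub_right, mul_sub,
      Finset.sum_sub_distrib]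
    linarith
  have e2 (w) (hw : w ∈ neighbors V v) : l v w * ⟪u, q w - B v u w⟫ =
      -(⟪S w u, y⟫ * g w - ⟪(B w v - B v u) u, y⟫ * g w) := by
    rw [mem_neighbors] at hw
    rcases eq_or_ne w u with rfl | hne
    · simp [hg, hB.right _ _ hw]
    · have hpos := hy w hw hne
      have h1 := hl v w hw u y
      rw [det4_swap23 v u w y] at h1
      have h2 : ⟪S w u, y⟫ - ⟪(B w v - B v u) u, y⟫ = l v w * -det4 v u w y := by
        rw [← h1, ← inner_sub_left, hS]
        simp
      rw [← sub_mul, h2, hg]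
      field_simp
  have e3 : ⟪u, ∑ w ∈ V, l v w • q w + m • q v⟫ =
      -∑ w ∈ neighbors V v, ⟪S w u, y⟫ * (g w - g (thirdVertex V v w)) := by
    rw [e1, sum_neighbors hl0, Finset.sum_congr rfl e2, Finset.sum_neg_distrib,
      Finset.sum_sub_distrib, ← sum_third hsymm (fun w => ⟪(B w v - B v u) u, y⟫ * g w),
      ← Finset.sum_sub_distrib]
    refine congrArg Neg.neg (Finset.sum_congr rfl fun w hw => ?_)
    rw [← hB.rotate (mem_neighbors.1 hw).posFacet_third.rotate.rotate, mul_sub]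
  have e4 (w) (hw : w ∈ neighbors V v) : ⟪S w u, y⟫ = 0 ∨
      0 < ⟪S w u, y⟫ * (g w - g (thirdVertex V v w)) := by
    rw [mem_neighbors] at hw
    have hf := hw.posFacet_third
    set a := thirdVertex V v w
    have hva : IsEdge V v a := hsymm _ _ ⟨w, hf.rotate.rotate⟩
    by_cases h0 : S w u = 0
    · simp [h0]
    have hwu : w ≠ u := by
      rintro rfl
      simp [hS] at h0
    have hau : a ≠ u := by
      intro h
      rw [hS] at h0
      simp only [LinearMap.sub_apply, hB.right _ _ hu] at h0
      rw [← h, hB.third _ _ _ hf, sub_self] at h0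
      exact h0 rfl
    have hw0 := hy w hw hwu
    have ha0 := hy a hva hau
    have hδ := hf.pos_of_ne hu.right_mem hu.ne.symm hwu.symm hau.symm
    have hskew : IsSkew (S w) := (hB.skew _ _ hw).sub (hB.skew _ _ hu)
    have hSv : S w v = 0 := by simp [hS, hB.left _ _ hw, hB.left _ _ hu]
    have hqw : q w - B v u w = S w w := by simp [hS, hB.right _ _ hw]
    have hqa : q a - B v u a = S w a := by simp [hS, hB.third _ _ _ hf]
    have hcr := congrArg (fun z => ⟪S w u, z⟫) (det4_smul v u w y a)
    have hδ' : det4 v u w a = det4 v w a u := by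
      simp only [det4_eq]; ring
    simp only [inner_add_right, inner_smul_right, hskew.inner_self, hskew u v, hSv,
      inner_zero_right, hδ', neg_zero, mul_zero, zero_add] at hcr
    rw [hskew u w, hskew u a] at hcr
    have hgg : g w - g a = det4 v w a u * ⟪S w u, y⟫ / (det4 v u w y * det4 v u a y) := by
      simp only [hg, hqw, hqa]
      rw [div_sub_div _ _ hw0.ne' ha0.ne']
      congr 1
      linarith
    by_cases hM : ⟪S w u, y⟫ = 0
    · exact Or.inl hM
    · right
      rw [hgg]
      have : 0 < ⟪S w u, y⟫ ^ 2 := by positivity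
      have h2 : ⟪S w u, y⟫ * (det4 v w a u * ⟪S w u, y⟫ / (det4 v u w y * det4 v u a y)) =
        det4 v w a u * ⟪S w u, y⟫ ^ 2 / (det4 v u w y * det4 v u a y) := by ring
      rw [h2]
      positivity
  have e5 (w) (hw : w ∈ neighbors V v) : 0 ≤ ⟪S w u, y⟫ * (g w - g (thirdVertex V v w)) := by
    rcases e4 w hw with h | h
    · simp [h]
    · exact h.le
  rw [e3]
  refine ⟨neg_nonpos.2 (Finset.sum_nonneg e5), fun h w hw => ?_⟩
  rw [neg_eq_zero, Finset.sum_eq_zero_iff_of_nonneg e5] at h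
  have hw := mem_neighbors.2 hw
  rcases e4 w hw with h' | h'
  · exact h'
  · exact absurd (h w hw) h'.ne'

lemma PosFacet.ne_opposite (h : PosFacet V v w a) (h' : PosFacet V w v b) : a ≠ b := by
  rintro rfl
  obtain ⟨x, hx, hpos⟩ := h.2.2.2.1
  have hv : x ≠ v := by rintro rfl; simp [det4_self_outer] at hpos
  have hw : x ≠ w := by rintro rfl; simp [det4_self_two_four] at hpos
  have ha : x ≠ a := by rintro rfl; simp [det4_self_right] at hpos
  have := h'.pos_of_ne hx hw hv ha
  rw [det4_swap12] at this
  linarith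

/-- Inside the dihedral angle between two adjacent facets. -/
lemma PosFacet.pos_sub (ha : PosFacet V v w a) (hb : PosFacet V w v b) {t : ℝ} (ht : 0 < t)
    (hx : x ∈ V) (hxv : x ≠ v) (hxw : x ≠ w) : 0 < det4 v w x (t • b - a) := by
  have hdet : det4 v w x (t • b - a) = det4 v w a x + t * det4 w v b x := by
    simp only [det4_eq, PiLp.sub_apply, PiLp.smul_apply, smul_eq_mul]; ring
  rw [hdet]
  rcases eq_or_ne x a with rfl | hxa
  · have := hb.pos_of_ne hx hxw hxv (ha.ne_opposite hb)
    rw [det4_self_right]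
    positivity
  · have h1 := ha.pos_of_ne hx hxv hxw hxa
    rcases eq_or_ne x b with rfl | hxb
    · rw [det4_self_right]
      linarith
    · have := hb.pos_of_ne hx hxw hxv hxb
      positivity

/-- All facets at a vertex rotate in the same way if the stress form vanishes there. -/
lemma IsFacetRotation.eq_of_inner_stress_eq_zero (hB : IsFacetRotation V q B)
    (hsymm : ∀ v w, IsEdge V v w → IsEdge V w v)
    {l : EuclideanSpace ℝ (Fin 4) → EuclideanSpace ℝ (Fin 4) → ℝ}
    (hl0 : ∀ v w, ¬ IsEdge V v w → l v w = 0)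
    (hl : ∀ v w, IsEdge V v w → ∀ x y, ⟪(B v w - B w v) x, y⟫ = l v w * det4 v w x y)
    {m : ℝ} (hm : ∑ w ∈ V, l v w • w + m • v = 0)
    (h0 : ∀ u ∈ V, ⟪u, ∑ w ∈ V, l v w • q w + m • q v⟫ = 0)
    {w w' : EuclideanSpace ℝ (Fin 4)} (hw : IsEdge V v w) (hw' : IsEdge V v w') :
    B v w = B v w' := by
  have key (w u) (hw : IsEdge V v w) (hu : IsEdge V v u) : B v w u = q u := by
    obtain ⟨a, ha⟩ := id hu
    obtain ⟨b, hb⟩ := hsymm _ _ hu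
    have hz (t : ℝ) (ht : 0 < t) :=
      (hB.inner_stress_nonpos hsymm hl0 hl hm hu
        fun x hx hxu => ha.pos_sub hb ht hx.right_mem hx.ne.symm hxu).2 (h0 u hu.right_mem) w hw
    have h1 := hz 1 one_pos
    have h2 := hz 2 two_pos
    rw [inner_sub_right, inner_smul_right] at h1 h2
    have hskew := (hB.skew _ _ hw).sub (hB.skew _ _ hu)
    have hpos := ha.pos_of_ne hb.2.2.1 hb.rotate.ne.symm hb.rotate.rotate.ne
      (ha.ne_opposite hb).symm
    have : (B v w - B v u) u = 0 := by
      refine eq_zero_of_inner_eq_zero hpos.ne' ?_ (hskew.inner_self u) ?_ ?_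
      · rw [hskew u v, LinearMap.sub_apply, hB.left _ _ hw, hB.left _ _ hu, sub_self,
          inner_zero_right, neg_zero]
      · linarith
      · linarith
    rwa [LinearMap.sub_apply, hB.right _ _ hu, sub_eq_zero] at this
  have hf := hw.posFacet_third
  obtain ⟨x, -, hx⟩ := hf.2.2.2.1
  have ha : IsEdge V v (thirdVertex V v w) := hsymm _ _ ⟨w, hf.rotate.rotate⟩
  refine (hB.skew _ _ hw).eq_of_eq_on (hB.skew _ _ hw') hx.ne' ?_ ?_ ?_
  · rw [hB.left _ _ hw, hB.left _ _ hw']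
  · rw [key w w hw hw, key w' w hw' hw]
  · rw [key w _ hw ha, key w' _ hw' ha]

/-- Rigidity in terms of the facet structure of the cone. -/
lemma IsFacetRotation.exists_isSkew (hB : IsFacetRotation V q B)
    (hsymm : ∀ v w, IsEdge V v w → IsEdge V w v) (hV : V.Nonempty)
    (hedge : ∀ v ∈ V, ∃ w, IsEdge V v w)
    (hmin : ∀ v ∈ V, ∀ g : EuclideanSpace ℝ (Fin 4), ⟪g, v⟫ = 0 →
      (∀ w, IsEdge V v w → 0 ≤ ⟪g, w⟫) → ∀ u ∈ V, 0 ≤ ⟪g, u⟫)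
    (hexp : ∀ u ∈ V, ∃ k : EuclideanSpace ℝ (Fin 4),
      ⟪k, u⟫ = 0 ∧ ∀ x ∈ V, x ≠ u → 0 < ⟪k, x⟫)
    (hpos : ∃ η : EuclideanSpace ℝ (Fin 4), ∀ v ∈ V, 0 < ⟪η, v⟫) :
    ∃ A, IsSkew A ∧ ∀ v ∈ V, q v = A v := by
  obtain ⟨η, hη⟩ := hpos
  obtain ⟨l, hlsymm, hl0, hl⟩ := hB.exists_stress hsymm
  have hequi (v) : ∃ m : ℝ, v ∈ V → ∑ w ∈ V, l v w • w + m • v = 0 := by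
    by_cases hv : v ∈ V
    · obtain ⟨m, hm⟩ := hB.exists_equilibrium hsymm hl0 hl (hedge v hv)
      exact ⟨m, fun _ => hm⟩
    · exact ⟨0, fun h => absurd h hv⟩
  choose m hm using hequi
  set r : EuclideanSpace ℝ (Fin 4) → EuclideanSpace ℝ (Fin 4) :=
    fun v => ∑ w ∈ V, l v w • q w + m v • q v with hr
  have hrself (v) (hv : v ∈ V) : ⟪r v, v⟫ = 0 := by
    obtain ⟨w₀, hw₀⟩ := hedge v hv
    have hvv : ⟪q v, v⟫ = 0 := by
      rw [← hB.left _ _ hw₀]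
      exact (hB.skew _ _ hw₀).inner_self v
    have h1 (w) : l v w * ⟪q w, v⟫ = -(l v w * ⟪q v, w⟫) := by
      by_cases hw : IsEdge V v w
      · rw [← hB.left _ _ hw, ← hB.right _ _ hw, hB.skew _ _ hw w v, real_inner_comm w]
        ring
      · simp [hl0 _ _ hw]
    have h2 := congrArg (fun z => ⟪q v, z⟫) (hm v hv)
    simp only [inner_add_right, inner_sum, inner_smul_right, inner_zero_right, hvv, mul_zero,
      add_zero] at h2
    simp only [hr, inner_add_left, sum_inner, real_inner_smul_left, h1, Finset.sum_neg_distrib,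
      h2, hvv, mul_zero, neg_zero, add_zero]
  have hrnonneg (v) (hv : v ∈ V) (u) (hu : u ∈ V) : 0 ≤ ⟪-r v, u⟫ := by
    refine hmin v hv (-r v) (by rw [inner_neg_left, hrself v hv, neg_zero]) (fun w hw => ?_) u hu
    obtain ⟨a, ha⟩ := id hw
    obtain ⟨b, hb⟩ := hsymm _ _ hw
    have := (hB.inner_stress_nonpos hsymm hl0 hl (hm v hv) (y := (1 : ℝ) • b - a) hw
      fun x hx hxw => ha.pos_sub hb one_pos hx.right_mem hx.ne.symm hxw).1
    rw [inner_neg_left, real_inner_comm]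
    linarith
  have hsum : ∑ v ∈ V, ⟪η, v⟫ • r v = 0 := by
    have h1 (w) (hw : w ∈ V) : (∑ v ∈ V, ⟪η, v⟫ * l v w) + ⟪η, w⟫ * m w = 0 := by
      have := congrArg (fun z => ⟪η, z⟫) (hm w hw)
      simp only [inner_add_right, inner_sum, inner_smul_right, inner_zero_right] at this
      rw [← this]
      congr 1
      · exact Finset.sum_congr rfl fun v _ => by rw [hlsymm v w, mul_comm]
      · rw [mul_comm]
    simp only [hr, smul_add, Finset.smul_sum, Finset.sum_add_distrib, smul_smul]
    rw [Finset.sum_comm, ← Finset.sum_add_distrib]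
    refine Finset.sum_eq_zero fun w hw => ?_
    rw [← Finset.sum_smul, ← add_smul, h1 w hw, zero_smul]
  have hr0 (v) (hv : v ∈ V) (u) (hu : u ∈ V) : ⟪u, r v⟫ = 0 := by
    have h1 : ∑ v ∈ V, ⟪η, v⟫ * ⟪-r v, u⟫ = 0 := by
      have := congrArg (fun z => ⟪z, u⟫) hsum
      simp only [sum_inner, real_inner_smul_left, inner_zero_left] at this
      simp only [inner_neg_left, mul_neg, Finset.sum_neg_distrib, this, neg_zero]
    rw [Finset.sum_eq_zero_iff_of_nonneg
      fun v hv => mul_nonneg (hη v hv).le (hrnonneg v hv u hu)] at h1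
    have := (mul_eq_zero.1 (h1 v hv)).resolve_left (hη v hv).ne'
    rwa [inner_neg_left, neg_eq_zero, real_inner_comm] at this
  have hloc (v w w') (hw : IsEdge V v w) (hw' : IsEdge V v w') : B v w = B v w' :=
    hB.eq_of_inner_stress_eq_zero hsymm hl0 hl (hm v hw.left_mem) (hr0 v hw.left_mem) hw hw'
  obtain ⟨v₀, hv₀⟩ := hV
  obtain ⟨w₀, hw₀⟩ := hedge v₀ hv₀
  set A := B v₀ w₀
  have hstep (v) (hv : ∀ w, IsEdge V v w → B v w = A) (w) (hw : IsEdge V v w) :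
      ∀ x, IsEdge V w x → B w x = A := by
    intro x hx
    obtain ⟨b, hb⟩ := hsymm _ _ hw
    have hvb : IsEdge V v b := ⟨w, hb.rotate⟩
    rw [hloc w x v hx ⟨b, hb⟩, ← hB.rotate hb, hv b hvb]
  have hall : ∀ u ∈ V, ∀ w, IsEdge V u w → B u w = A := by
    classical
    intro u hu
    by_contra hcon
    obtain ⟨k, hku, hk⟩ := hexp u hu
    obtain ⟨v, hvS, hvmin⟩ := Finset.exists_min_image
      (V.filter fun v => ∀ w, IsEdge V v w → B v w = A) (fun v => ⟪k, v⟫ / ⟪η, v⟫)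
      ⟨v₀, Finset.mem_filter.2 ⟨hv₀, fun w hw => hloc _ _ _ hw hw₀⟩⟩
    rw [Finset.mem_filter] at hvS
    have hvu : v ≠ u := by
      rintro rfl
      exact hcon hvS.2
    have hkv := hk v hvS.1 hvu
    have hηu := hη u hu
    have := hmin v hvS.1 (⟪η, v⟫ • k - ⟪k, v⟫ • η)
      (by rw [inner_sub_left, real_inner_smul_left, real_inner_smul_left]; ring)
      (fun w hw => ?_) u hu
    · rw [inner_sub_left, real_inner_smul_left, real_inner_smul_left, hku] at this
      have := mul_pos hkv hηu
      linarith
    · have hwS := hvmin w (Finset.mem_filter.2 ⟨hw.right_mem, hstep v hvS.2 w hw⟩)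
      rw [div_le_div_iff₀ (hη v hvS.1) (hη w hw.right_mem)] at hwS
      rw [inner_sub_left, real_inner_smul_left, real_inner_smul_left]
      linarith
  refine ⟨A, hB.skew _ _ hw₀, fun v hv => ?_⟩
  obtain ⟨w, hw⟩ := hedge v hv
  rw [← hall v hv w hw, hB.left _ _ hw]

end Facets

lemma exists_ne_zero_of_det4_eq_zero {a b c d : EuclideanSpace ℝ (Fin 4)}
    (h : det4 a b c d = 0) :
    ∃ n : EuclideanSpace ℝ (Fin 4),
      n ≠ 0 ∧ ⟪n, a⟫ = 0 ∧ ⟪n, b⟫ = 0 ∧ ⟪n, c⟫ = 0 ∧ ⟪n, d⟫ = 0 := by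
  obtain ⟨n, hn, hmul⟩ := Matrix.exists_mulVec_eq_zero_iff.2 h
  refine ⟨WithLp.toLp 2 n, fun h0 => hn (by simpa using h0), ?_, ?_, ?_, ?_⟩
  · have := congrFun hmul 0
    simpa [Matrix.mulVec, dotProduct, Fin.sum_univ_four, PiLp.inner_apply] using this
  · have := congrFun hmul 1
    simpa [Matrix.mulVec, dotProduct, Fin.sum_univ_four, PiLp.inner_apply] using this
  · have := congrFun hmul 2
    simpa [Matrix.mulVec, dotProduct, Fin.sum_univ_four, PiLp.inner_apply] using this
  · have := congrFun hmul 3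
    simpa [Matrix.mulVec, dotProduct, Fin.sum_univ_four, PiLp.inner_apply] using this

section Faces

/-- The functional `f` is determined up to scaling by its zeros in `V`. -/
def IsRigidAt (V : Finset (EuclideanSpace ℝ (Fin 4))) (f : EuclideanSpace ℝ (Fin 4)) : Prop :=
  ∀ g : EuclideanSpace ℝ (Fin 4), (∀ x ∈ V, ⟪f, x⟫ = 0 → ⟪g, x⟫ = 0) → ∃ c : ℝ, g = c • f

variable {V : Finset (EuclideanSpace ℝ (Fin 4))} {v w a b f : EuclideanSpace ℝ (Fin 4)}

lemma exists_pos_of_ne_zero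
    (hspan : ∀ g : EuclideanSpace ℝ (Fin 4), (∀ x ∈ V, ⟪g, x⟫ = 0) → g = 0)
    (hf : ∀ x ∈ V, 0 ≤ ⟪f, x⟫) (hf0 : f ≠ 0) : ∃ x ∈ V, 0 < ⟪f, x⟫ := by
  by_contra! h
  exact hf0 (hspan f fun x hx => le_antisymm (h x hx) (hf x hx))

/-- Rotating a supporting hyperplane until it supports a facet. -/
lemma exists_isRigidAt
    (hspan : ∀ g : EuclideanSpace ℝ (Fin 4), (∀ x ∈ V, ⟪g, x⟫ = 0) → g = 0)
    (hf : ∀ x ∈ V, 0 ≤ ⟪f, x⟫) (hf0 : f ≠ 0) :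
    ∃ f' : EuclideanSpace ℝ (Fin 4), f' ≠ 0 ∧ (∀ x ∈ V, 0 ≤ ⟪f', x⟫) ∧
      (∀ x ∈ V, ⟪f, x⟫ = 0 → ⟪f', x⟫ = 0) ∧ IsRigidAt V f' := by
  classical
  induction hn : (V.filter fun x => 0 < ⟪f, x⟫).card using Nat.strong_induction_on
    generalizing f with
  | _ n ih =>
    by_cases hr : IsRigidAt V f
    · exact ⟨f, hf0, hf, fun _ _ h => h, hr⟩
    simp only [IsRigidAt, not_forall, not_exists] at hr
    obtain ⟨g, hg, hgf⟩ := hr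
    obtain ⟨x₁, hx₁, hfx₁⟩ := exists_pos_of_ne_zero hspan hf hf0
    obtain ⟨y, hy, hmin⟩ := Finset.exists_min_image (V.filter fun x => 0 < ⟪f, x⟫)
      (fun x => ⟪g, x⟫ / ⟪f, x⟫) ⟨x₁, Finset.mem_filter.2 ⟨hx₁, hfx₁⟩⟩
    rw [Finset.mem_filter] at hy
    set t := ⟪g, y⟫ / ⟪f, y⟫ with ht
    have happ (x) : ⟪g - t • f, x⟫ = ⟪g, x⟫ - t * ⟪f, x⟫ := by
      rw [inner_sub_left, real_inner_smul_left]
    have hzero (x) (hx : x ∈ V) (h : ⟪f, x⟫ = 0) : ⟪g - t • f, x⟫ = 0 := by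
      rw [happ, h, hg x hx h]; ring
    have hnonneg (x) (hx : x ∈ V) : 0 ≤ ⟪g - t • f, x⟫ := by
      rcases (hf x hx).eq_or_lt with h | h
      · exact (hzero x hx h.symm).ge
      · have := hmin x (Finset.mem_filter.2 ⟨hx, h⟩)
        rw [le_div_iff₀ h] at this
        rw [happ]
        linarith
    have hy0 : ⟪g - t • f, y⟫ = 0 := by
      rw [happ, ht, div_mul_cancel₀ _ hy.2.ne', sub_self]
    have hlt : (V.filter fun x => 0 < ⟪g - t • f, x⟫).card < n := by
      rw [← hn]
      refine Finset.card_lt_card (Finset.ssubset_iff_of_subset ?_ |>.2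
        ⟨y, Finset.mem_filter.2 hy, by simp [hy0]⟩)
      intro x hx
      rw [Finset.mem_filter] at hx ⊢
      exact ⟨hx.1, (hf x hx.1).lt_of_ne fun h => hx.2.ne' (hzero x hx.1 h.symm)⟩
    obtain ⟨f', h0, hnn, hz, hrig⟩ :=
      ih _ hlt hnonneg (fun h => hgf t (sub_eq_zero.1 h)) rfl
    exact ⟨f', h0, hnn, fun x hx h => hz x hx (hzero x hx h), hrig⟩

lemma posFacet_or_posFacet
    (hspan : ∀ g : EuclideanSpace ℝ (Fin 4), (∀ x ∈ V, ⟪g, x⟫ = 0) → g = 0)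
    (hf : ∀ x ∈ V, 0 ≤ ⟪f, x⟫) (hf0 : f ≠ 0) (hr : IsRigidAt V f)
    (hv : v ∈ V) (hw : w ∈ V) (ha : a ∈ V)
    (hfv : ⟪f, v⟫ = 0) (hfw : ⟪f, w⟫ = 0) (hfa : ⟪f, a⟫ = 0)
    (hz : ∀ x ∈ V, ⟪f, x⟫ = 0 → x = v ∨ x = w ∨ x = a) :
    PosFacet V v w a ∨ PosFacet V w v a := by
  obtain ⟨x₁, hx₁, hfx₁⟩ := exists_pos_of_ne_zero hspan hf hf0
  have hD : det4 v w a x₁ ≠ 0 := by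
    intro h
    obtain ⟨n, hn, hnv, hnw, hna, hnx⟩ := exists_ne_zero_of_det4_eq_zero h
    obtain ⟨c, rfl⟩ := hr n fun x hx h => by
      rcases hz x hx h with rfl | rfl | rfl <;> assumption
    rw [real_inner_smul_left] at hnx
    exact hn (by rw [(mul_eq_zero.1 hnx).resolve_right hfx₁.ne', zero_smul])
  have key (x) : det4 v w a x₁ * ⟪f, x⟫ = det4 v w a x * ⟪f, x₁⟫ := by
    have := congrArg (fun z => ⟪f, z⟫) (det4_smul v w a x₁ x)
    simpa only [inner_add_right, inner_smul_right, hfv, hfw, hfa, mul_zero, zero_add] using this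
  have hpos (x) (hx : x ∈ V) : (x = v ∨ x = w ∨ x = a) ∨ 0 < ⟪f, x⟫ := by
    rcases (hf x hx).eq_or_lt with h | h
    · exact Or.inl (hz x hx h.symm)
    · exact Or.inr h
  rcases hD.lt_or_gt with h | h
  · refine Or.inr ⟨hw, hv, ha, ⟨x₁, hx₁, by rw [det4_swap12]; linarith⟩, fun x hx => ?_⟩
    rcases hpos x hx with h' | h'
    · tauto
    · refine Or.inr (Or.inr (Or.inr ?_))
      rw [det4_swap12]
      refine pos_of_mul_pos_left ?_ hfx₁.le
      have := key x
      nlinarith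
  · refine Or.inl ⟨hv, hw, ha, ⟨x₁, hx₁, h⟩, fun x hx => ?_⟩
    rcases hpos x hx with h' | h'
    · tauto
    · refine Or.inr (Or.inr (Or.inr ?_))
      refine pos_of_mul_pos_left ?_ hfx₁.le
      rw [← key x]
      positivity

lemma IsEdge.symm (hspan : ∀ g : EuclideanSpace ℝ (Fin 4), (∀ x ∈ V, ⟪g, x⟫ = 0) → g = 0)
    (hfacet : ∀ f : EuclideanSpace ℝ (Fin 4), f ≠ 0 → (∀ x ∈ V, 0 ≤ ⟪f, x⟫) → IsRigidAt V f →
      (V.filter fun x => ⟪f, x⟫ = 0).card = 3) (h : IsEdge V v w) : IsEdge V w v := by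
  classical
  obtain ⟨a, hva⟩ := h
  obtain ⟨hv, hw, ha, ⟨n, hn, hnpos⟩, hall⟩ := id hva
  obtain ⟨X, hX⟩ := exists_inner_eq_det4 v w a
  obtain ⟨Y, hY⟩ := exists_inner_eq_det4 w v n
  obtain ⟨b, hb, hmin⟩ := Finset.exists_min_image (V.filter fun x => 0 < ⟪X, x⟫)
    (fun x => ⟪Y, x⟫ / ⟪X, x⟫) ⟨n, Finset.mem_filter.2 ⟨hn, by rwa [hX]⟩⟩
  rw [Finset.mem_filter] at hb
  obtain ⟨hb, hXb⟩ := hb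
  set t := ⟪Y, b⟫ / ⟪X, b⟫ with ht
  have happ (x) : ⟪Y - t • X, x⟫ = ⟪Y, x⟫ - t * ⟪X, x⟫ := by
    rw [inner_sub_left, real_inner_smul_left]
  have hfv : ⟪Y - t • X, v⟫ = 0 := by
    rw [happ, hX, hY, det4_self_outer, det4_self_two_four]; ring
  have hfw : ⟪Y - t • X, w⟫ = 0 := by
    rw [happ, hX, hY, det4_self_outer, det4_self_two_four]; ring
  have hfb : ⟪Y - t • X, b⟫ = 0 := by
    rw [happ, ht, div_mul_cancel₀ _ hXb.ne', sub_self]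
  have hfa : 0 < ⟪Y - t • X, a⟫ := by
    rw [happ, hX, hY, det4_self_right, det4_swap12, det4_swap34]
    linarith
  have hf (x) (hx : x ∈ V) : 0 ≤ ⟪Y - t • X, x⟫ := by
    rcases hall x hx with rfl | rfl | rfl | h
    · exact hfv.ge
    · exact hfw.ge
    · exact hfa.le
    · rw [← hX] at h
      have := hmin x (Finset.mem_filter.2 ⟨hx, h⟩)
      rw [le_div_iff₀ h] at this
      rw [happ]
      linarith
  have hf0 : Y - t • X ≠ 0 := by
    intro h
    rw [h, inner_zero_left] at hfa
    exact hfa.false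
  rw [hX] at hXb
  have hr : IsRigidAt V (Y - t • X) := fun g hg => by
    refine ⟨⟪g, a⟫ / ⟪Y - t • X, a⟫, sub_eq_zero.1 (eq_zero_of_inner_eq_zero hXb.ne' ?_ ?_ ?_ ?_)⟩
    · rw [inner_sub_left, real_inner_smul_left, hg v hv hfv, hfv]; ring
    · rw [inner_sub_left, real_inner_smul_left, hg w hw hfw, hfw]; ring
    · rw [inner_sub_left, real_inner_smul_left, div_mul_cancel₀ _ hfa.ne', sub_self]
    · rw [inner_sub_left, real_inner_smul_left, hg b hb hfb, hfb]; ring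
  have hbv : b ≠ v := by rintro rfl; simp [det4_self_outer] at hXb
  have hbw : b ≠ w := by rintro rfl; simp [det4_self_two_four] at hXb
  have hba : b ≠ a := by rintro rfl; simp [det4_self_right] at hXb
  have hsub : ({v, w, b} : Finset (EuclideanSpace ℝ (Fin 4))) ⊆
      V.filter fun x => ⟪Y - t • X, x⟫ = 0 := by
    intro x hx
    simp only [Finset.mem_insert, Finset.mem_singleton] at hx
    rw [Finset.mem_filter]
    rcases hx with rfl | rfl | rfl <;> exact ⟨by assumption, by assumption⟩
  have heq := Finset.eq_of_subset_of_card_le hsub (by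
    rw [hfacet _ hf0 hf hr, Finset.card_eq_three.2 ⟨v, w, b, hva.ne, hbv.symm, hbw.symm, rfl⟩])
  rcases posFacet_or_posFacet hspan hf hf0 hr hv hw hb hfv hfw hfb (fun x hx h => by
    have : x ∈ V.filter fun x => ⟪Y - t • X, x⟫ = 0 := Finset.mem_filter.2 ⟨hx, h⟩
    simpa [← heq] using this) with h | h
  · have := h.pos_of_ne ha hva.rotate.rotate.ne hva.rotate.ne.symm hba.symm
    rw [det4_swap34] at this
    linarith
  · exact ⟨b, h⟩

lemma isEdge_of_support
    (hspan : ∀ g : EuclideanSpace ℝ (Fin 4), (∀ x ∈ V, ⟪g, x⟫ = 0) → g = 0)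
    (hfacet : ∀ f : EuclideanSpace ℝ (Fin 4), f ≠ 0 → (∀ x ∈ V, 0 ≤ ⟪f, x⟫) → IsRigidAt V f →
      (V.filter fun x => ⟪f, x⟫ = 0).card = 3)
    (hf : ∀ x ∈ V, 0 ≤ ⟪f, x⟫) (hf0 : f ≠ 0) (hr : IsRigidAt V f)
    (hv : v ∈ V) (hw : w ∈ V) (hvw : v ≠ w) (hfv : ⟪f, v⟫ = 0) (hfw : ⟪f, w⟫ = 0) :
    IsEdge V v w := by
  classical
  have hcard := hfacet f hf0 hf hr
  have hsub : ({v, w} : Finset (EuclideanSpace ℝ (Fin 4))) ⊆ V.filter fun x => ⟪f, x⟫ = 0 := by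
    intro x hx
    simp only [Finset.mem_insert, Finset.mem_singleton] at hx
    rw [Finset.mem_filter]
    rcases hx with rfl | rfl <;> exact ⟨by assumption, by assumption⟩
  have hone : ((V.filter fun x => ⟪f, x⟫ = 0) \ {v, w}).card = 1 := by
    rw [Finset.card_sdiff_of_subset hsub, hcard, Finset.card_pair hvw]
  obtain ⟨a, ha⟩ := Finset.card_eq_one.1 hone
  have hmem : a ∈ (V.filter fun x => ⟪f, x⟫ = 0) \ {v, w} := ha ▸ Finset.mem_singleton_self a
  rw [Finset.mem_sdiff, Finset.mem_filter] at hmem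
  rcases posFacet_or_posFacet hspan hf hf0 hr hv hw hmem.1.1 hfv hfw hmem.1.2
    (fun x hx h => by
      by_contra! hx'
      have : x ∈ (V.filter fun x => ⟪f, x⟫ = 0) \ {v, w} := by simp [hx, h, hx'.1, hx'.2.1]
      rw [ha, Finset.mem_singleton] at this
      exact hx'.2.2 this) with h | h
  · exact ⟨a, h⟩
  · exact IsEdge.symm hspan hfacet ⟨a, h⟩

lemma isEdge_of_nonneg
    (hspan : ∀ g : EuclideanSpace ℝ (Fin 4), (∀ x ∈ V, ⟪g, x⟫ = 0) → g = 0)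
    (hfacet : ∀ f : EuclideanSpace ℝ (Fin 4), f ≠ 0 → (∀ x ∈ V, 0 ≤ ⟪f, x⟫) → IsRigidAt V f →
      (V.filter fun x => ⟪f, x⟫ = 0).card = 3)
    (hf : ∀ x ∈ V, 0 ≤ ⟪f, x⟫) (hf0 : f ≠ 0)
    (hv : v ∈ V) (hw : w ∈ V) (hvw : v ≠ w) (hfv : ⟪f, v⟫ = 0) (hfw : ⟪f, w⟫ = 0) :
    IsEdge V v w := by
  obtain ⟨f', h0, hnn, hz, hr⟩ := exists_isRigidAt hspan hf hf0
  exact isEdge_of_support hspan hfacet hnn h0 hr hv hw hvw (hz v hv hfv) (hz w hw hfw)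

lemma exists_isEdge
    (hspan : ∀ g : EuclideanSpace ℝ (Fin 4), (∀ x ∈ V, ⟪g, x⟫ = 0) → g = 0)
    (hfacet : ∀ f : EuclideanSpace ℝ (Fin 4), f ≠ 0 → (∀ x ∈ V, 0 ≤ ⟪f, x⟫) → IsRigidAt V f →
      (V.filter fun x => ⟪f, x⟫ = 0).card = 3)
    (hf : ∀ x ∈ V, 0 ≤ ⟪f, x⟫) (hf0 : f ≠ 0) (hv : v ∈ V) (hfv : ⟪f, v⟫ = 0) :
    ∃ w, IsEdge V v w := by
  classical
  obtain ⟨f', h0, hnn, hz, hr⟩ := exists_isRigidAt hspan hf hf0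
  obtain ⟨w, hw, hwv⟩ := Finset.exists_mem_ne
    (by rw [hfacet f' h0 hnn hr]; norm_num : 1 < (V.filter fun x => ⟪f', x⟫ = 0).card) v
  rw [Finset.mem_filter] at hw
  exact ⟨w, isEdge_of_support hspan hfacet hnn h0 hr hv hw.1 hwv.symm (hz v hv hfv) hw.2⟩

/-- Linear forms on the cone vanishing at a vertex are controlled by the adjacent vertices. -/
lemma nonneg_of_nonneg_on_neighbors
    (hspan : ∀ g : EuclideanSpace ℝ (Fin 4), (∀ x ∈ V, ⟪g, x⟫ = 0) → g = 0)
    (hfacet : ∀ f : EuclideanSpace ℝ (Fin 4), f ≠ 0 → (∀ x ∈ V, 0 ≤ ⟪f, x⟫) → IsRigidAt V f →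
      (V.filter fun x => ⟪f, x⟫ = 0).card = 3)
    (hv : v ∈ V) (hedge : ∃ w, IsEdge V v w)
    {k : EuclideanSpace ℝ (Fin 4)} (hkv : ⟪k, v⟫ = 0) (hk : ∀ x ∈ V, x ≠ v → 0 < ⟪k, x⟫)
    {g : EuclideanSpace ℝ (Fin 4)} (hgv : ⟪g, v⟫ = 0)
    (hg : ∀ w, IsEdge V v w → 0 ≤ ⟪g, w⟫) {u : EuclideanSpace ℝ (Fin 4)} (hu : u ∈ V) :
    0 ≤ ⟪g, u⟫ := by
  classical
  obtain ⟨w, hw⟩ := hedge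
  obtain ⟨y, hy, hmin⟩ := Finset.exists_min_image (V.erase v) (fun x => ⟪g, x⟫ / ⟪k, x⟫)
    ⟨w, Finset.mem_erase.2 ⟨hw.ne.symm, hw.right_mem⟩⟩
  rw [Finset.mem_erase] at hy
  have hky := hk y hy.2 hy.1
  set t := ⟪g, y⟫ / ⟪k, y⟫ with ht
  have happ (x) : ⟪g - t • k, x⟫ = ⟪g, x⟫ - t * ⟪k, x⟫ := by
    rw [inner_sub_left, real_inner_smul_left]
  have hfv : ⟪g - t • k, v⟫ = 0 := by rw [happ, hgv, hkv]; ring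
  have hf (x) (hx : x ∈ V) : 0 ≤ ⟪g - t • k, x⟫ := by
    rcases eq_or_ne x v with rfl | hxv
    · exact hfv.ge
    · have := hmin x (Finset.mem_erase.2 ⟨hxv, hx⟩)
      rw [le_div_iff₀ (hk x hx hxv)] at this
      rw [happ]
      linarith
  have ht0 : 0 ≤ t := by
    by_cases hf0 : g - t • k = 0
    · have h1 := hg w hw
      rw [sub_eq_zero.1 hf0, real_inner_smul_left] at h1
      exact nonneg_of_mul_nonneg_left h1 (hk w hw.right_mem hw.ne.symm)
    · have hy0 : ⟪g - t • k, y⟫ = 0 := by rw [happ, ht, div_mul_cancel₀ _ hky.ne', sub_self]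
      exact div_nonneg
        (hg y (isEdge_of_nonneg hspan hfacet hf hf0 hv hy.2 hy.1.symm hfv hy0)) hky.le
  rcases eq_or_ne u v with rfl | huv
  · exact hgv.ge
  · have h1 := hf u hu
    rw [happ] at h1
    have := mul_nonneg ht0 (hk u hu huv).le
    linarith

end Faces

section Cone

/-- The convex cone generated by a finite set. -/
def coneOver (V : Finset (EuclideanSpace ℝ (Fin 4))) : Set (EuclideanSpace ℝ (Fin 4)) :=
  {x | ∃ c : EuclideanSpace ℝ (Fin 4) → ℝ, (∀ v, 0 ≤ c v) ∧ x = ∑ v ∈ V, c v • v}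

variable {V : Finset (EuclideanSpace ℝ (Fin 4))} {v w a b f x : EuclideanSpace ℝ (Fin 4)}

lemma smul_mem_coneOver (hv : v ∈ V) {t : ℝ} (ht : 0 ≤ t) : t • v ∈ coneOver V := by
  classical
  refine ⟨fun x => if x = v then t else 0, fun x => by dsimp only; split_ifs <;> simp [ht], ?_⟩
  simp [ite_smul, hv]

lemma add_mem_coneOver (hx : x ∈ coneOver V) (hw : w ∈ coneOver V) : x + w ∈ coneOver V := by
  obtain ⟨c, hc, rfl⟩ := hx
  obtain ⟨d, hd, rfl⟩ := hw
  exact ⟨c + d, fun v => add_nonneg (hc v) (hd v), by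
    simp only [Pi.add_apply, add_smul, Finset.sum_add_distrib]⟩

lemma mem_coneOver (hv : v ∈ V) : v ∈ coneOver V := by
  simpa using smul_mem_coneOver hv zero_le_one

lemma zero_mem_coneOver : (0 : EuclideanSpace ℝ (Fin 4)) ∈ coneOver V :=
  ⟨fun _ => 0, fun _ => le_rfl, by simp⟩

lemma coneOver_subset_span : coneOver V ⊆ Submodule.span ℝ (V : Set (EuclideanSpace ℝ (Fin 4))) := by
  rintro _ ⟨c, -, rfl⟩
  exact Submodule.sum_mem _ fun v hv => Submodule.smul_mem _ _ (Submodule.subset_span hv)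

lemma inner_nonneg_of_mem_coneOver (hf : ∀ x ∈ V, 0 ≤ ⟪f, x⟫) (hx : x ∈ coneOver V) :
    0 ≤ ⟪f, x⟫ := by
  obtain ⟨c, hc, rfl⟩ := hx
  simp only [inner_sum, inner_smul_right]
  exact Finset.sum_nonneg fun v hv => mul_nonneg (hc v) (hf v hv)

/-- A point of a supporting hyperplane only involves generators in that hyperplane. -/
lemma exists_sum_of_inner_eq_zero (hf : ∀ x ∈ V, 0 ≤ ⟪f, x⟫) (hx : x ∈ coneOver V)
    (h0 : ⟪f, x⟫ = 0) :
    ∃ c : EuclideanSpace ℝ (Fin 4) → ℝ, (∀ v, 0 ≤ c v) ∧ x = ∑ v ∈ V, c v • v ∧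
      ∀ v ∈ V, ⟪f, v⟫ ≠ 0 → c v = 0 := by
  obtain ⟨c, hc, rfl⟩ := hx
  refine ⟨c, hc, rfl, fun v hv hfv => ?_⟩
  simp only [inner_sum, inner_smul_right] at h0
  rw [Finset.sum_eq_zero_iff_of_nonneg fun v hv => mul_nonneg (hc v) (hf v hv)] at h0
  exact (mul_eq_zero.1 (h0 v hv)).resolve_right hfv

lemma isExposed_inner_eq_zero (hf : ∀ x ∈ V, 0 ≤ ⟪f, x⟫) :
    IsExposed ℝ (coneOver V) {x | x ∈ coneOver V ∧ ⟪f, x⟫ = 0} := by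
  refine fun _ => ⟨-innerSL ℝ f, ?_⟩
  ext x
  simp only [Set.mem_ofPred_eq, neg_apply, innerSL_apply_apply, neg_le_neg_iff]
  refine and_congr_right fun hx => ⟨fun h y hy => ?_, fun h => ?_⟩
  · rw [h]
    exact inner_nonneg_of_mem_coneOver hf hy
  · refine le_antisymm ?_ (inner_nonneg_of_mem_coneOver hf hx)
    simpa using h 0 zero_mem_coneOver

lemma span_inner_eq_zero (hf : ∀ x ∈ V, 0 ≤ ⟪f, x⟫) :
    Submodule.span ℝ {x | x ∈ coneOver V ∧ ⟪f, x⟫ = 0} =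
      Submodule.span ℝ {x | x ∈ V ∧ ⟪f, x⟫ = 0} := by
  refine le_antisymm (Submodule.span_le.2 ?_)
    (Submodule.span_mono fun x hx => ⟨mem_coneOver hx.1, hx.2⟩)
  rintro x ⟨hx, h0⟩
  obtain ⟨c, -, rfl, hc⟩ := exists_sum_of_inner_eq_zero hf hx h0
  refine Submodule.sum_mem _ fun v hv => ?_
  by_cases h : ⟪f, v⟫ = 0
  · exact Submodule.smul_mem _ _ (Submodule.subset_span ⟨hv, h⟩)
  · rw [hc v hv h, zero_smul]
    exact Submodule.zero_mem _

lemma finrank_span_of_isRigidAt (hf0 : f ≠ 0) (hr : IsRigidAt V f) :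
    Module.finrank ℝ (Submodule.span ℝ {x | x ∈ V ∧ ⟪f, x⟫ = 0}) = 3 := by
  have horth : (Submodule.span ℝ {x | x ∈ V ∧ ⟪f, x⟫ = 0})ᗮ = Submodule.span ℝ {f} := by
    ext g
    rw [Submodule.mem_span_singleton, Submodule.mem_orthogonal]
    constructor
    · intro h
      obtain ⟨c, hc⟩ := hr g fun x hx h0 => by
        rw [real_inner_comm]
        exact h x (Submodule.subset_span ⟨hx, h0⟩)
      exact ⟨c, hc.symm⟩
    · rintro ⟨c, rfl⟩ u hu
      induction hu using Submodule.span_induction with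
      | mem x hx => rw [inner_smul_right, real_inner_comm, hx.2, mul_zero]
      | zero => exact inner_zero_left _
      | add x y _ _ hx hy => rw [inner_add_left, hx, hy, add_zero]
      | smul t x _ hx => rw [real_inner_smul_left, hx, mul_zero]
  have h1 := Submodule.finrank_add_finrank_orthogonal
    (Submodule.span ℝ {x | x ∈ V ∧ ⟪f, x⟫ = 0})
  rw [horth, finrank_span_singleton hf0, finrank_euclideanSpace, Fintype.card_fin] at h1
  omega

lemma eq_zero_of_interior_coneOver_nonempty (hint : (interior (coneOver V)).Nonempty)
    {g : EuclideanSpace ℝ (Fin 4)} (hg : ∀ x ∈ V, ⟪g, x⟫ = 0) : g = 0 := by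
  have htop := Submodule.eq_top_of_nonempty_interior' _
    (hint.mono (interior_mono coneOver_subset_span))
  have hmem : g ∈ Submodule.span ℝ (V : Set (EuclideanSpace ℝ (Fin 4))) := htop ▸ trivial
  have key (u) (hu : u ∈ Submodule.span ℝ (V : Set (EuclideanSpace ℝ (Fin 4)))) : ⟪g, u⟫ = 0 := by
    induction hu using Submodule.span_induction with
    | mem x hx => exact hg x hx
    | zero => exact inner_zero_right _
    | add x y _ _ hx hy => rw [inner_add_right, hx, hy, add_zero]
    | smul t x _ hx => rw [inner_smul_right, hx, mul_zero]
  exact inner_self_eq_zero.1 (key g hmem)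

lemma exists_supporting_of_isExposed_ray (hunit : ∀ v ∈ V, ‖v‖ = 1) (hv : v ∈ V)
    (hray : IsExposed ℝ (coneOver V) {x | ∃ t : ℝ, 0 ≤ t ∧ x = t • v}) :
    ∃ k : EuclideanSpace ℝ (Fin 4), ⟪k, v⟫ = 0 ∧ ∀ x ∈ V, x ≠ v → 0 < ⟪k, x⟫ := by
  obtain ⟨l, hl⟩ := hray ⟨0, 0, le_rfl, by simp⟩
  rw [Set.ext_iff] at hl
  have hk (x) : ⟪-(InnerProductSpace.toDual ℝ _).symm l, x⟫ = -l x := by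
    rw [inner_neg_left, InnerProductSpace.toDual_symm_apply]
  have h0 := ((hl 0).1 ⟨0, le_rfl, by simp⟩).2
  simp only [map_zero] at h0
  refine ⟨-(InnerProductSpace.toDual ℝ _).symm l, ?_, fun x hx hxv => ?_⟩
  · have := ((hl v).1 ⟨1, zero_le_one, by simp⟩).2 0 zero_mem_coneOver
    rw [map_zero] at this
    rw [hk, le_antisymm (h0 v (mem_coneOver hv)) this, neg_zero]
  · rw [hk, neg_pos]
    refine (h0 x (mem_coneOver hx)).lt_of_ne fun hlx => hxv ?_
    obtain ⟨t, ht, hxt⟩ := (hl x).2 ⟨mem_coneOver hx, fun y hy => hlx ▸ h0 y hy⟩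
    have := congrArg norm hxt
    rw [norm_smul, hunit x hx, hunit v hv, mul_one, Real.norm_of_nonneg ht] at this
    rw [hxt, ← this, one_smul]

/-- Two adjacent facets expose their common edge. -/
lemma isExposed_edge (ha : PosFacet V v w a) (hb : PosFacet V w v b) :
    IsExposed ℝ (coneOver V) {x | ∃ s t : ℝ, 0 ≤ s ∧ 0 ≤ t ∧ x = s • v + t • w} ∧
      Module.finrank ℝ
        (Submodule.span ℝ {x | ∃ s t : ℝ, 0 ≤ s ∧ 0 ≤ t ∧ x = s • v + t • w}) = 2 := by
  classical
  obtain ⟨X, hX⟩ := exists_inner_eq_det4 v w a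
  obtain ⟨Y, hY⟩ := exists_inner_eq_det4 w v b
  have happ (x) : ⟪X + Y, x⟫ = det4 v w a x + det4 w v b x := by rw [inner_add_left, hX, hY]
  have hfv : ⟪X + Y, v⟫ = 0 := by rw [happ, det4_self_outer, det4_self_two_four, add_zero]
  have hfw : ⟪X + Y, w⟫ = 0 := by rw [happ, det4_self_outer, det4_self_two_four, add_zero]
  have hpos (x) (hx : x ∈ V) (hxv : x ≠ v) (hxw : x ≠ w) : 0 < ⟪X + Y, x⟫ := by
    have := ha.pos_sub hb one_pos hx hxv hxw
    rw [happ]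
    convert this using 1
    simp only [det4_eq, PiLp.sub_apply, one_smul]; ring
  have hf (x) (hx : x ∈ V) : 0 ≤ ⟪X + Y, x⟫ := by
    rcases eq_or_ne x v with rfl | hxv
    · exact hfv.ge
    rcases eq_or_ne x w with rfl | hxw
    · exact hfw.ge
    exact (hpos x hx hxv hxw).le
  constructor
  · convert isExposed_inner_eq_zero hf using 1
    ext x
    constructor
    · rintro ⟨s, t, hs, ht, rfl⟩
      refine ⟨add_mem_coneOver (smul_mem_coneOver ha.1 hs) (smul_mem_coneOver hb.1 ht), ?_⟩
      rw [inner_add_right, inner_smul_right, inner_smul_right, hfv, hfw]; ring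
    · rintro ⟨hx, h0⟩
      obtain ⟨c, hc, rfl, hc0⟩ := exists_sum_of_inner_eq_zero hf hx h0
      refine ⟨c v, c w, hc v, hc w, ?_⟩
      rw [← Finset.sum_pair (f := fun x => c x • x) ha.ne]
      refine (Finset.sum_subset (fun x hx => ?_) fun x hx hxvw => ?_).symm
      · simp only [Finset.mem_insert, Finset.mem_singleton] at hx
        rcases hx with rfl | rfl
        exacts [ha.1, hb.1]
      · simp only [Finset.mem_insert, Finset.mem_singleton, not_or] at hxvw
        rw [hc0 x hx (hpos x hx hxvw.1 hxvw.2).ne', zero_smul]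
  · obtain ⟨x, -, hx⟩ := ha.2.2.2.1
    have hli : LinearIndependent ℝ ![v, w] := by
      refine LinearIndependent.pair_iff.2 fun s t hst => ?_
      have h1 := congrArg (det4Linear w a x) hst
      have h2 := congrArg (det4Linear v a x) hst
      simp only [map_add, map_smul, det4Linear_apply, smul_eq_mul, det4_self_outer, mul_zero,
        add_zero, zero_add, map_zero, mul_eq_zero] at h1 h2
      refine ⟨h1.resolve_right fun h => hx.ne' ?_, h2.resolve_right fun h => hx.ne' ?_⟩
      · rw [← neg_eq_zero, ← h]
        simp only [det4_eq]; ring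
      · rw [← h]
        simp only [det4_eq]; ring
    have hspan : Submodule.span ℝ {x | ∃ s t : ℝ, 0 ≤ s ∧ 0 ≤ t ∧ x = s • v + t • w} =
        Submodule.span ℝ (Set.range ![v, w]) := by
      rw [Matrix.range_cons_cons_empty]
      refine le_antisymm (Submodule.span_le.2 ?_) (Submodule.span_le.2 ?_)
      · rintro _ ⟨s, t, -, -, rfl⟩
        exact Submodule.mem_span_pair.2 ⟨s, t, rfl⟩
      · rintro _ (rfl | rfl)
        · exact Submodule.subset_span ⟨1, 0, zero_le_one, le_rfl, by simp⟩
        · exact Submodule.subset_span ⟨0, 1, le_rfl, zero_le_one, by simp⟩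
    rw [hspan, finrank_span_eq_card hli, Fintype.card_fin]

end Cone

/-- First-order isometric velocities on the facets come from infinitesimal rotations. -/
lemma exists_isFacetRotation {V : Finset (EuclideanSpace ℝ (Fin 4))}
    {q : EuclideanSpace ℝ (Fin 4) → EuclideanSpace ℝ (Fin 4)}
    (htangent : ∀ v ∈ V, ⟪v, q v⟫ = 0)
    (hedge : ∀ v w, IsEdge V v w → ⟪q v, w⟫ + ⟪v, q w⟫ = 0) :
    ∃ B, IsFacetRotation V q B := by
  classical
  have key (v w) : ∃ A, ∀ a, PosFacet V v w a →
      IsSkew A ∧ A v = q v ∧ A w = q w ∧ A a = q a := by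
    by_cases h : IsEdge V v w
    · obtain ⟨a, ha⟩ := h
      obtain ⟨x, -, hx⟩ := ha.2.2.2.1
      obtain ⟨A, hA⟩ := _root_.exists_isSkew hx.ne' (htangent v ha.1) (htangent w ha.2.1)
        (htangent a ha.2.2.1) (hedge v w ⟨a, ha⟩) (hedge w a ⟨v, ha.rotate⟩)
        (hedge a v ⟨w, ha.rotate.rotate⟩)
      exact ⟨A, fun b hb => ha.unique hb ▸ hA⟩
    · exact ⟨0, fun a ha => absurd ⟨a, ha⟩ h⟩
  choose B hB using key
  exact ⟨B, fun v w ⟨a, h⟩ => (hB v w a h).1, fun v w ⟨a, h⟩ => (hB v w a h).2.1,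
    fun v w ⟨a, h⟩ => (hB v w a h).2.2.1, fun v w a h => (hB v w a h).2.2.2⟩

/-- Infinitesimal metric rigidity of convex spherical polyhedra: let `P = C ∩ S³` be a
simplicial convex spherical polyhedron, where `C ⊂ ℝ⁴` is the closed convex cone
generated by the finite set `V ⊂ S³` of vertices. If `q : V → ℝ⁴` is tangential
(`⟨v, q(v)⟩ = 0`) and keeps the geodesic edge lengths constant in the first order
(`⟨q(v), w⟩ + ⟨v, q(w)⟩ = 0` for every edge `{v, w}`), then `q` is the restriction of an
infinitesimal rotation, i.e. of a skew-symmetric linear map of ℝ⁴. -/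
theorem spherical_metric_rigidity
    (V : Finset (EuclideanSpace ℝ (Fin 4))) (hunit : ∀ v ∈ V, ‖v‖ = 1)
    (C : Set (EuclideanSpace ℝ (Fin 4)))
    (hC : C = {x | ∃ c : EuclideanSpace ℝ (Fin 4) → ℝ,
      (∀ v, 0 ≤ c v) ∧ x = ∑ v ∈ V, c v • v})
    (hint : (interior C).Nonempty)
    (hpointed : C ∩ (-C) = {0})
    (hextreme : ∀ v ∈ V, IsExposed ℝ C {x | ∃ t : ℝ, 0 ≤ t ∧ x = t • v})
    (hdistinctrays : ∀ v ∈ V, ∀ w ∈ V, v ≠ w →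
      {x | ∃ t : ℝ, 0 ≤ t ∧ x = t • v} ≠ {x | ∃ t : ℝ, 0 ≤ t ∧ x = t • w})
    (hsimplicial : ∀ G : Set (EuclideanSpace ℝ (Fin 4)), IsExposed ℝ C G →
      Module.finrank ℝ (Submodule.span ℝ G) = 3 →
      ((V : Set (EuclideanSpace ℝ (Fin 4))) ∩ G).ncard = 3)
    (q : EuclideanSpace ℝ (Fin 4) → EuclideanSpace ℝ (Fin 4))
    (htangent : ∀ v ∈ V, ⟪v, q v⟫ = 0)
    (hedge : ∀ v ∈ V, ∀ w ∈ V, v ≠ w →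
      (IsExposed ℝ C {x | ∃ s t : ℝ, 0 ≤ s ∧ 0 ≤ t ∧ x = s • v + t • w} ∧
        Module.finrank ℝ
          (Submodule.span ℝ {x | ∃ s t : ℝ, 0 ≤ s ∧ 0 ≤ t ∧ x = s • v + t • w}) = 2) →
      ⟪q v, w⟫ + ⟪v, q w⟫ = 0) :
    ∃ A : EuclideanSpace ℝ (Fin 4) →ₗ[ℝ] EuclideanSpace ℝ (Fin 4),
      (∀ x y, ⟪A x, y⟫ = -⟪x, A y⟫) ∧ ∀ v ∈ V, q v = A v := by
  classical
  change C = coneOver V at hC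
  subst hC
  have hspan : ∀ g : EuclideanSpace ℝ (Fin 4), (∀ x ∈ V, ⟪g, x⟫ = 0) → g = 0 :=
    fun g hg => eq_zero_of_interior_coneOver_nonempty hint hg
  have hfacet (f : EuclideanSpace ℝ (Fin 4)) (hf0 : f ≠ 0) (hf : ∀ x ∈ V, 0 ≤ ⟪f, x⟫)
      (hr : IsRigidAt V f) : (V.filter fun x => ⟪f, x⟫ = 0).card = 3 := by
    have h3 := hsimplicial _ (isExposed_inner_eq_zero hf)
      (by rw [span_inner_eq_zero hf, finrank_span_of_isRigidAt hf0 hr])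
    rw [← h3, ← Set.ncard_coe_finset]
    congr 1
    ext x
    simp only [Finset.coe_filter, Set.mem_ofPred_eq, Set.mem_inter_iff, Finset.mem_coe]
    exact ⟨fun h => ⟨h.1, mem_coneOver h.1, h.2⟩, fun h => ⟨h.1, h.2.2⟩⟩
  have hexp (v) (hv : v ∈ V) := exists_supporting_of_isExposed_ray hunit hv (hextreme v hv)
  have hV (v : EuclideanSpace ℝ (Fin 4)) : ∃ w ∈ V, w ≠ v := by
    by_contra! h
    obtain ⟨n, hn, hnv, -⟩ := exists_ne_zero_of_det4_eq_zero (det4_self_left v v v)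
    exact hn (hspan n fun x hx => h x hx ▸ hnv)
  have hadj (v) (hv : v ∈ V) : ∃ w, IsEdge V v w := by
    obtain ⟨k, hkv, hk⟩ := hexp v hv
    obtain ⟨w, hw, hwv⟩ := hV v
    refine exists_isEdge hspan hfacet (f := k) (fun x hx => ?_) ?_ hv hkv
    · rcases eq_or_ne x v with rfl | hxv
      exacts [hkv.ge, (hk x hx hxv).le]
    · rintro rfl
      simpa using hk w hw hwv
  obtain ⟨B, hB⟩ := exists_isFacetRotation htangent fun v w h => by
    obtain ⟨a, ha⟩ := id h
    obtain ⟨b, hb⟩ := IsEdge.symm hspan hfacet h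
    exact hedge v h.left_mem w h.right_mem h.ne (isExposed_edge ha hb)
  refine hB.exists_isSkew (fun v w => IsEdge.symm hspan hfacet) ((hV 0).imp fun _ h => h.1) hadj
    (fun v hv g hgv hg u hu => ?_) hexp ?_
  · obtain ⟨k, hkv, hk⟩ := hexp v hv
    exact nonneg_of_nonneg_on_neighbors hspan hfacet hv (hadj v hv) hkv hk hgv hg hu
  · choose! k hkv hk using hexp
    refine ⟨∑ u ∈ V, k u, fun v hv => ?_⟩
    obtain ⟨w, hw, hwv⟩ := hV v
    rw [sum_inner]
    refine Finset.sum_pos' (fun u hu => ?_) ⟨w, hw, hk w hw v hv hwv.symm⟩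
    rcases eq_or_ne v u with rfl | hvu
    exacts [(hkv v hv).ge, (hk u hu v hv hvu).le]
end

section
/- Let m ≥ 3, let ρ : ZMod m → (0, π) and α : ZMod m → (0, π) satisfy Σⱼ αⱼ = 2π. For each j define cⱼ ∈ (0, π) by cos cⱼ = cos ρⱼ·cos ρ_{j+1} + sin ρⱼ·sin ρ_{j+1}·cos αⱼ, and set βⱼ = ang(ρ_{j+1}; ρⱼ, cⱼ) and γⱼ = ang(ρⱼ; ρ_{j+1}, cⱼ). Assume strict convexity: βⱼ + γ_{j−1} < π for every j. Let L be the symmetric m×m real matrix indexed by ZMod m with entries L_{jj} = −(cot α_{j−1} + cot αⱼ)/sin²ρⱼ, L_{j,j+1} = L_{j+1,j} = 1/(sin αⱼ · sin ρⱼ · sin ρ_{j+1}), and 0 elsewhere. Then L has exactly one positive eigenvalue, the eigenvalue 0 with multiplicity exactly 2, and exactly m−3 negative eigenvalues (counted with multiplicity); moreover ⟨s, L·s⟩ > 0 for the vector s with sⱼ = cos ρⱼ. -/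
/-- `sAng z x y` is the angle opposite the side of length `z` in a spherical triangle
with side lengths `x`, `y`, `z` (spherical law of cosines). -/
noncomputable def sAng (z x y : ℝ) : ℝ :=
  Real.arccos ((Real.cos z - Real.cos x * Real.cos y) / (Real.sin x * Real.sin y))

/-- `x`, `y`, `z` are the side lengths of a valid (nondegenerate) spherical triangle. -/
def ValidTriangle (x y z : ℝ) : Prop :=
  0 < x ∧ x < Real.pi ∧ 0 < y ∧ y < Real.pi ∧ 0 < z ∧ z < Real.pi ∧
    |x - y| < z ∧ z < x + y ∧ x + y + z < 2 * Real.pi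

open Matrix

section CyclicSums

variable {m : ℕ} [NeZero m]

/-- The sum of `f` over the residues preceding `j`. -/
noncomputable def cyclicPrefix (f : ZMod m → ℝ) (j : ZMod m) : ℝ :=
  ∑ i ∈ Finset.range j.val, f (i : ZMod m)

theorem sum_range_natCast_zmod (f : ZMod m → ℝ) :
    ∑ i ∈ Finset.range m, f (i : ZMod m) = ∑ j, f j := by
  refine Finset.sum_bij (fun i _ => (i : ZMod m)) (fun _ _ => Finset.mem_univ _) ?_ ?_
    (fun _ _ => rfl)
  · intro a ha b hb hab
    rw [Finset.mem_range] at ha hb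
    have := congrArg ZMod.val hab
    rwa [ZMod.val_cast_of_lt ha, ZMod.val_cast_of_lt hb] at this
  · intro j _
    exact ⟨j.val, Finset.mem_range.2 (ZMod.val_lt j), ZMod.natCast_zmod_val j⟩

theorem sum_add_one_zmod (f : ZMod m → ℝ) : ∑ j, f (j + 1) = ∑ j, f j :=
  Equiv.sum_comp (Equiv.addRight (1 : ZMod m)) f

theorem cyclicPrefix_zero {m : ℕ} (f : ZMod m → ℝ) : cyclicPrefix f 0 = 0 := by
  simp [cyclicPrefix]

theorem zmod_add_one_cases (j : ZMod m) :
    (j.val + 1 < m ∧ (j + 1).val = j.val + 1) ∨ (j.val + 1 = m ∧ j + 1 = 0) := by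
  have h : j + 1 = ((j.val + 1 : ℕ) : ZMod m) := by simp
  rcases lt_or_eq_of_le (Nat.succ_le_of_lt (ZMod.val_lt j)) with h1 | h1
  · left
    refine ⟨h1, ?_⟩
    rw [h, ZMod.val_cast_of_lt h1]
  · right
    refine ⟨h1, ?_⟩
    rw [h]
    have : j.val + 1 = m := h1
    rw [this]
    simp

theorem cyclicPrefix_add_one (f : ZMod m → ℝ) (j : ZMod m) :
    cyclicPrefix f (j + 1) = cyclicPrefix f j + f j ∨
      cyclicPrefix f (j + 1) + ∑ i, f i = cyclicPrefix f j + f j := by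
  have hs : ∑ i ∈ Finset.range (j.val + 1), f (i : ZMod m) = cyclicPrefix f j + f j := by
    rw [Finset.sum_range_succ, ZMod.natCast_zmod_val, cyclicPrefix]
  rcases zmod_add_one_cases j with ⟨_, h⟩ | ⟨h, h0⟩
  · left
    rw [← hs, cyclicPrefix, h]
  · right
    rw [← hs, h, h0, cyclicPrefix_zero, sum_range_natCast_zmod, zero_add]

theorem cyclicPrefix_nonneg {m : ℕ} {f : ZMod m → ℝ} (hf : ∀ j, 0 ≤ f j) (j : ZMod m) :
    0 ≤ cyclicPrefix f j := Finset.sum_nonneg fun _ _ => hf _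

theorem cyclicPrefix_mono {m : ℕ} {f : ZMod m → ℝ} (hf : ∀ j, 0 ≤ f j) {i j : ZMod m}
    (hij : i.val ≤ j.val) : cyclicPrefix f i ≤ cyclicPrefix f j :=
  Finset.sum_le_sum_of_subset_of_nonneg (Finset.range_mono hij) fun _ _ _ => hf _

theorem cyclicPrefix_le_sum {f : ZMod m → ℝ} (hf : ∀ j, 0 ≤ f j) (j : ZMod m) :
    cyclicPrefix f j ≤ ∑ i, f i := by
  rw [← sum_range_natCast_zmod]
  exact Finset.sum_le_sum_of_subset_of_nonneg (Finset.range_mono (ZMod.val_lt j).le)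
    fun _ _ _ => hf _

end CyclicSums

section SupportNumbers

variable {m : ℕ} [NeZero m]

/-- The edge lengths of the planar polygon with exterior angles `α` and support numbers `u`. -/
noncomputable def edgeLength (α u : ZMod m → ℝ) (j : ZMod m) : ℝ :=
  (u (j + 1) - Real.cos (α j) * u j) / Real.sin (α j) +
    (u (j - 1) - Real.cos (α (j - 1)) * u j) / Real.sin (α (j - 1))

/-- The sine of the direction of the `j`-th normal. -/
noncomputable def normalSin (α : ZMod m → ℝ) (j : ZMod m) : ℝ := Real.sin (cyclicPrefix α j)

/-- The cosine of the direction of the `j`-th normal. -/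
noncomputable def normalCos (α : ZMod m → ℝ) (j : ZMod m) : ℝ := Real.cos (cyclicPrefix α j)

theorem normalSin_add_one {α : ZMod m → ℝ} (hsum : ∑ j, α j = 2 * Real.pi) (j : ZMod m) :
    normalSin α (j + 1) =
      normalSin α j * Real.cos (α j) + normalCos α j * Real.sin (α j) := by
  rw [normalSin, normalSin, normalCos, ← Real.sin_add]
  rcases cyclicPrefix_add_one α j with h | h
  · rw [h]
  · rw [← h, hsum, Real.sin_add_two_pi]

theorem normalCos_add_one {α : ZMod m → ℝ} (hsum : ∑ j, α j = 2 * Real.pi) (j : ZMod m) :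
    normalCos α (j + 1) =
      normalCos α j * Real.cos (α j) - normalSin α j * Real.sin (α j) := by
  rw [normalCos, normalSin, normalCos, ← Real.cos_add]
  rcases cyclicPrefix_add_one α j with h | h
  · rw [h]
  · rw [← h, hsum, Real.cos_add_two_pi]

theorem normalSin_sub_one {α : ZMod m → ℝ} (hsum : ∑ j, α j = 2 * Real.pi) (j : ZMod m) :
    normalSin α (j - 1) =
      normalSin α j * Real.cos (α (j - 1)) - normalCos α j * Real.sin (α (j - 1)) := by
  have h1 := normalSin_add_one hsum (j - 1)
  have h2 := normalCos_add_one hsum (j - 1)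
  rw [sub_add_cancel] at h1 h2
  rw [h1, h2]
  linear_combination -normalSin α (j - 1) * Real.sin_sq_add_cos_sq (α (j - 1))

theorem normalCos_sub_one {α : ZMod m → ℝ} (hsum : ∑ j, α j = 2 * Real.pi) (j : ZMod m) :
    normalCos α (j - 1) =
      normalCos α j * Real.cos (α (j - 1)) + normalSin α j * Real.sin (α (j - 1)) := by
  have h1 := normalSin_add_one hsum (j - 1)
  have h2 := normalCos_add_one hsum (j - 1)
  rw [sub_add_cancel] at h1 h2
  rw [h1, h2]
  linear_combination -normalCos α (j - 1) * Real.sin_sq_add_cos_sq (α (j - 1))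

theorem normalSin_zero {m : ℕ} (α : ZMod m → ℝ) : normalSin α 0 = 0 := by
  simp [normalSin, cyclicPrefix_zero]

theorem normalCos_zero {m : ℕ} (α : ZMod m → ℝ) : normalCos α 0 = 1 := by
  simp [normalCos, cyclicPrefix_zero]

theorem edgeLength_normalSin {α : ZMod m → ℝ} (hα : ∀ j, 0 < Real.sin (α j))
    (hsum : ∑ j, α j = 2 * Real.pi) (j : ZMod m) : edgeLength α (normalSin α) j = 0 := by
  have h1 := (hα j).ne'
  have h2 := (hα (j - 1)).ne'
  rw [edgeLength, normalSin_add_one hsum, normalSin_sub_one hsum]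
  field_simp
  ring

theorem edgeLength_normalCos {α : ZMod m → ℝ} (hα : ∀ j, 0 < Real.sin (α j))
    (hsum : ∑ j, α j = 2 * Real.pi) (j : ZMod m) : edgeLength α (normalCos α) j = 0 := by
  have h1 := (hα j).ne'
  have h2 := (hα (j - 1)).ne'
  rw [edgeLength, normalCos_add_one hsum, normalCos_sub_one hsum]
  field_simp
  ring

theorem edgeLength_add_smul {m : ℕ} (α u v : ZMod m → ℝ) (a b : ℝ) (j : ZMod m) :
    edgeLength α (a • u + b • v) j = a * edgeLength α u j + b * edgeLength α v j := by
  simp only [edgeLength, Pi.add_apply, Pi.smul_apply, smul_eq_mul]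
  ring

theorem sum_mul_edgeLength (α u v : ZMod m → ℝ) :
    ∑ j, v j * edgeLength α u j =
      ∑ j, (v j * u (j + 1) + v (j + 1) * u j -
        Real.cos (α j) * (v j * u j + v (j + 1) * u (j + 1))) / Real.sin (α j) := by
  have h := sum_add_one_zmod (fun j =>
    v j * ((u (j - 1) - Real.cos (α (j - 1)) * u j) / Real.sin (α (j - 1))))
  simp only [add_sub_cancel_right] at h
  simp only [edgeLength, mul_add, Finset.sum_add_distrib]
  rw [← h, ← Finset.sum_add_distrib]
  refine Finset.sum_congr rfl fun j _ => ?_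
  ring

theorem sum_mul_edgeLength_comm (α u v : ZMod m → ℝ) :
    ∑ j, v j * edgeLength α u j = ∑ j, u j * edgeLength α v j := by
  rw [sum_mul_edgeLength, sum_mul_edgeLength]
  refine Finset.sum_congr rfl fun j _ => ?_
  ring

/-- Picone-type inequality: an edge on which the comparison solution does not change sign, or
to which `u` is proportional there, contributes at most a telescoping term. -/
theorem edge_form_le {s c s' c' u u' σ κ : ℝ} (hσ : 0 < σ)
    (hs : s' = s * κ + c * σ) (hc : c' = c * κ - s * σ) (hκ : σ ^ 2 + κ ^ 2 = 1)
    (h0 : s = 0 → u = 0) (h0' : s' = 0 → u' = 0)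
    (hsign : 0 ≤ s * s' ∨ u * s' = u' * s) :
    (u * u' + u' * u - κ * (u * u + u' * u')) / σ ≤ u ^ 2 * c / s - u' ^ 2 * c' / s' := by
  have hcσ : c * σ = s' - s * κ := by linarith
  have hcσ' : c' * σ = s' * κ - s := by
    rw [hc, hs]; linear_combination (-s) * hκ
  by_cases hs0 : s = 0
  · have hu := h0 hs0
    by_cases hs0' : s' = 0
    · simp [hu, h0' hs0']
    · refine le_of_eq ?_
      subst hs0
      rw [hu]
      field_simp
      linear_combination u' ^ 2 * hcσ'
  by_cases hs0' : s' = 0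
  · have hu := h0' hs0'
    refine le_of_eq ?_
    subst hs0'
    rw [hu]
    field_simp
    linear_combination (-u ^ 2) * hcσ
  have key : u ^ 2 * c / s - u' ^ 2 * c' / s' -
      (u * u' + u' * u - κ * (u * u + u' * u')) / σ =
      (u * s' - u' * s) ^ 2 / (s * s' * σ) := by
    field_simp
    linear_combination (u ^ 2 * s') * hcσ - (u' ^ 2 * s) * hcσ'
  rw [← sub_nonneg, key]
  rcases hsign with h | h
  · positivity
  · rw [h]; simp

end SupportNumbers

section Definiteness

variable {m : ℕ} [NeZero m]

theorem exists_crossing {α : ZMod m → ℝ} (hα : ∀ j, 0 < α j)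
    (hsum : ∑ j, α j = 2 * Real.pi) :
    ∃ k : ZMod m,
      (∀ j, normalSin α j = 0 → j = 0 ∨ j = k) ∧
      ∀ j, j ≠ k → 0 ≤ normalSin α j * normalSin α (j + 1) := by
  set th : ℕ → ℝ := fun n => ∑ i ∈ Finset.range n, α (i : ZMod m) with hth
  have hmono : StrictMono th := by
    refine strictMono_nat_of_lt_succ fun n => ?_
    simp only [hth, Finset.sum_range_succ]
    linarith [hα (n : ZMod m)]
  have hth0 : th 0 = 0 := by simp [hth]
  have hthm : th m = 2 * Real.pi := by
    rw [hth, ← hsum]; exact sum_range_natCast_zmod α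
  have hpi := Real.pi_pos
  have hpre : ∀ j : ZMod m, normalSin α j = Real.sin (th j.val) := fun j => rfl
  have hnext : ∀ j : ZMod m, normalSin α (j + 1) = Real.sin (th (j.val + 1)) := by
    intro j
    rcases zmod_add_one_cases j with ⟨_, h⟩ | ⟨h, h0⟩
    · rw [hpre, h]
    · rw [h0, h, hthm, normalSin_zero, Real.sin_two_pi]
  have hneg : ∀ x, Real.pi < x → x < 2 * Real.pi → Real.sin x < 0 := by
    intro x h1 h2
    have := Real.sin_pos_of_pos_of_lt_pi (x := x - Real.pi) (by linarith) (by linarith)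
    rw [Real.sin_sub_pi] at this
    linarith
  have hneg' : ∀ x, Real.pi < x → x ≤ 2 * Real.pi → Real.sin x ≤ 0 := by
    intro x h1 h2
    rcases h2.lt_or_eq with h | h
    · exact (hneg x h1 h).le
    · rw [h, Real.sin_two_pi]
  have hex : ∃ n, Real.pi < th (n + 1) := ⟨m, by
    have := hmono (Nat.lt_succ_self m); linarith⟩
  classical
  obtain ⟨k, hk1, hk2⟩ : ∃ k, Real.pi < th (k + 1) ∧ th k ≤ Real.pi := by
    refine ⟨Nat.find hex, Nat.find_spec hex, ?_⟩
    rcases Nat.eq_zero_or_pos (Nat.find hex) with h | h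
    · rw [h, hth0]; exact hpi.le
    · have := Nat.find_min hex (m := Nat.find hex - 1) (by omega)
      rw [Nat.sub_add_cancel h] at this
      linarith
  have hlt : ∀ j : ZMod m, th j.val < 2 * Real.pi := by
    intro j; rw [← hthm]; exact hmono (ZMod.val_lt j)
  have hle : ∀ j : ZMod m, th (j.val + 1) ≤ 2 * Real.pi := by
    intro j; rw [← hthm]; exact hmono.monotone (ZMod.val_lt j)
  have hnn : ∀ n, 0 ≤ th n := by
    intro n; rw [← hth0]; exact hmono.monotone (Nat.zero_le n)
  refine ⟨(k : ZMod m), ?_, ?_⟩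
  · intro j h0
    rw [hpre] at h0
    rcases lt_trichotomy (th j.val) Real.pi with h | h | h
    · left
      rcases (hnn j.val).lt_or_eq with h1 | h1
      · exact absurd h0 (Real.sin_pos_of_pos_of_lt_pi h1 h).ne'
      · rw [← hth0] at h1
        exact (ZMod.val_eq_zero j).1 (hmono.injective h1).symm
    · right
      have h1 : j.val < k + 1 := by rw [← hmono.lt_iff_lt]; linarith
      have h2 : k < j.val + 1 := by
        rw [← hmono.lt_iff_lt]
        linarith [hmono (Nat.lt_succ_self j.val)]
      rw [← ZMod.natCast_zmod_val j]
      congr 1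
      omega
    · exact absurd h0 (hneg _ h (hlt j)).ne
  · intro j hj
    have hjk : j.val ≠ k := by
      rintro rfl
      exact hj (ZMod.natCast_zmod_val j).symm
    rw [hpre, hnext]
    rcases lt_or_gt_of_ne hjk with h | h
    · have h1 : th (j.val + 1) ≤ Real.pi := (hmono.monotone h).trans hk2
      have h2 : th j.val ≤ Real.pi := (hmono (Nat.lt_succ_self j.val)).le.trans h1
      exact mul_nonneg (Real.sin_nonneg_of_nonneg_of_le_pi (hnn _) h2)
        (Real.sin_nonneg_of_nonneg_of_le_pi (hnn _) h1)
    · have h1 : Real.pi < th j.val := hk1.trans_le (hmono.monotone h)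
      have h2 : Real.pi < th (j.val + 1) := h1.trans (hmono (Nat.lt_succ_self _))
      exact mul_nonneg_of_nonpos_of_nonpos (hneg' _ h1 (hlt j).le) (hneg' _ h2 (hle j))

theorem normalSin_sq_add_normalCos_sq {m : ℕ} (α : ZMod m → ℝ) (j : ZMod m) :
    normalSin α j ^ 2 + normalCos α j ^ 2 = 1 := Real.sin_sq_add_cos_sq _

/-- The quadratic form `u ↦ ⟨u, edgeLength u⟩` is nonpositive on a hyperplane. -/
theorem exists_hyperplane_nonpos {α : ZMod m → ℝ} (hα : ∀ j, 0 < α j ∧ α j < Real.pi)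
    (hsum : ∑ j, α j = 2 * Real.pi) :
    ∃ φ : (ZMod m → ℝ) →ₗ[ℝ] ℝ, ∀ u, φ u = 0 → ∑ j, u j * edgeLength α u j ≤ 0 := by
  have hsin : ∀ j, 0 < Real.sin (α j) := fun j =>
    Real.sin_pos_of_pos_of_lt_pi (hα j).1 (hα j).2
  obtain ⟨k, hk0, hk⟩ := exists_crossing (fun j => (hα j).1) hsum
  let S := normalSin α
  let C := normalCos α
  refine ⟨LinearMap.proj 0 + (Real.sin (α k))⁻¹ •
    (S k • LinearMap.proj (k + 1) - S (k + 1) • LinearMap.proj k), fun u hu => ?_⟩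
  simp only [LinearMap.add_apply, LinearMap.smul_apply, LinearMap.sub_apply,
    LinearMap.proj_apply, smul_eq_mul] at hu
  have hσ := (hsin k).ne'
  set v : ZMod m → ℝ := (1 : ℝ) • u + (-u 0) • C with hv
  have hvj : ∀ j, v j = u j - u 0 * C j := fun j => by
    simp [hv]; ring
  have hv0 : v 0 = 0 := by
    rw [hvj]; simp [C, normalCos_zero]
  have hSk : S (k + 1) = S k * Real.cos (α k) + C k * Real.sin (α k) :=
    normalSin_add_one hsum k
  have hCk : C (k + 1) = C k * Real.cos (α k) - S k * Real.sin (α k) :=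
    normalCos_add_one hsum k
  have hSC : S k ^ 2 + C k ^ 2 = 1 := normalSin_sq_add_normalCos_sq α k
  have hvk : v k * S (k + 1) = v (k + 1) * S k := by
    rw [hvj, hvj]
    have hu' : u 0 * Real.sin (α k) + (S k * u (k + 1) - S (k + 1) * u k) = 0 := by
      field_simp at hu
      linarith
    linear_combination -hu' + u 0 * S k * hCk - u 0 * C k * hSk - u 0 * Real.sin (α k) * hSC
  have hq : ∀ j, edgeLength α v j = edgeLength α u j := fun j => by
    rw [hv, edgeLength_add_smul, edgeLength_normalCos hsin hsum]; ring
  have hform : ∑ j, u j * edgeLength α u j = ∑ j, v j * edgeLength α v j := by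
    calc ∑ j, u j * edgeLength α u j = ∑ j, u j * edgeLength α v j := by simp only [hq]
      _ = ∑ j, v j * edgeLength α u j := sum_mul_edgeLength_comm α v u
      _ = _ := by simp only [hq]
  have hzero : ∀ j, S j = 0 → v j = 0 := by
    intro j hj
    rcases hk0 j hj with rfl | rfl
    · exact hv0
    · have h1 : S (j + 1) ≠ 0 := by
        rw [hSk, hj, zero_mul, zero_add]
        refine mul_ne_zero (fun h => ?_) hσ
        rw [hj, h] at hSC
        norm_num at hSC
      rw [hj, mul_zero] at hvk
      exact (mul_eq_zero.1 hvk).resolve_right h1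
  rw [hform, sum_mul_edgeLength]
  calc _ ≤ ∑ j, (v j ^ 2 * C j / S j - v (j + 1) ^ 2 * C (j + 1) / S (j + 1)) := by
        refine Finset.sum_le_sum fun j _ => ?_
        refine edge_form_le (hsin j) (normalSin_add_one hsum j) (normalCos_add_one hsum j)
          (Real.sin_sq_add_cos_sq _) (hzero j) (hzero (j + 1)) ?_
        by_cases hj : j = k
        · right; rw [hj]; exact hvk
        · left; exact hk j hj
    _ = 0 := by
        rw [Finset.sum_sub_distrib, sub_eq_zero]
        exact (sum_add_one_zmod fun j => v j ^ 2 * C j / S j).symm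

/-- A support vector all of whose edge lengths are positive has positive area. -/
theorem sum_mul_edgeLength_pos {α : ZMod m → ℝ}
    (hα : ∀ j, 0 < α j ∧ α j < Real.pi)
    (hsum : ∑ j, α j = 2 * Real.pi) {h : ZMod m → ℝ} (hpos : ∀ j, 0 < edgeLength α h j) :
    0 < ∑ j, h j * edgeLength α h j := by
  have hsin : ∀ j, 0 < Real.sin (α j) := fun j =>
    Real.sin_pos_of_pos_of_lt_pi (hα j).1 (hα j).2
  set ℓ := edgeLength α h with hℓ
  set S := normalSin α with hS
  set C := normalCos α with hC
  have hsumS : ∑ j, ℓ j * S j = 0 := by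
    simp only [mul_comm (ℓ _)]
    rw [sum_mul_edgeLength_comm]
    simp [hS, edgeLength_normalSin hsin hsum]
  have hsumC : ∑ j, ℓ j * C j = 0 := by
    simp only [mul_comm (ℓ _)]
    rw [sum_mul_edgeLength_comm]
    simp [hC, edgeLength_normalCos hsin hsum]
  set X := cyclicPrefix fun j => ℓ j * C j with hX
  set Y := cyclicPrefix fun j => ℓ j * S j with hY
  have hX1 : ∀ j, X (j + 1) = X j + ℓ j * C j := by
    intro j
    rcases cyclicPrefix_add_one (fun j => ℓ j * C j) j with h | h
    · exact h
    · rwa [hsumC, add_zero] at h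
  have hY1 : ∀ j, Y (j + 1) = Y j + ℓ j * S j := by
    intro j
    rcases cyclicPrefix_add_one (fun j => ℓ j * S j) j with h | h
    · exact h
    · rwa [hsumS, add_zero] at h
  set u : ZMod m → ℝ := fun j => S j * X j - C j * Y j with hu
  have hSC : ∀ j, S j ^ 2 + C j ^ 2 = 1 := normalSin_sq_add_normalCos_sq α
  have hnext : ∀ j, u (j + 1) = S (j + 1) * X j - C (j + 1) * Y j + ℓ j * Real.sin (α j) := by
    intro j
    have h1 : S (j + 1) = S j * Real.cos (α j) + C j * Real.sin (α j) := normalSin_add_one hsum j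
    have h2 : C (j + 1) = C j * Real.cos (α j) - S j * Real.sin (α j) := normalCos_add_one hsum j
    simp only [hu, hX1, hY1]
    linear_combination ℓ j * C j * h1 - ℓ j * S j * h2 + ℓ j * Real.sin (α j) * hSC j
  have hprev : ∀ j, u (j - 1) = S (j - 1) * X j - C (j - 1) * Y j := by
    intro j
    have h1 := hX1 (j - 1)
    have h2 := hY1 (j - 1)
    rw [sub_add_cancel] at h1 h2
    simp only [hu, h1, h2]
    ring
  have hqu : ∀ j, edgeLength α u j = ℓ j := by
    intro j
    have h1 := edgeLength_normalSin hsin hsum j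
    have h2 := edgeLength_normalCos hsin hsum j
    have h3 := (hsin j).ne'
    have h4 : u j = S j * X j - C j * Y j := rfl
    rw [edgeLength] at h1 h2 ⊢
    rw [hnext, hprev, h4]
    have h5 : ℓ j * Real.sin (α j) / Real.sin (α j) = ℓ j := mul_div_cancel_right₀ _ h3
    rw [← hS] at h1
    rw [← hC] at h2
    linear_combination X j * h1 - Y j * h2 + h5
  have hu0 : ∀ j, 0 ≤ u j := by
    intro j
    have hα0 : ∀ j, 0 ≤ α j := fun j => (hα j).1.le
    let P := cyclicPrefix α
    let g : ZMod m → ℝ := fun i => ℓ i * Real.sin (P j - P i)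
    have hg : ∀ i, g i = S j * (ℓ i * C i) - C j * (ℓ i * S i) := by
      intro i
      simp only [g, Real.sin_sub, hS, hC, normalSin, normalCos, P]
      ring
    have hug : u j = ∑ i ∈ Finset.range j.val, g (i : ZMod m) := by
      simp only [hg, hu, hX, hY, cyclicPrefix, Finset.sum_sub_distrib, Finset.mul_sum]
    have hgm : ∑ i ∈ Finset.range m, g (i : ZMod m) = 0 := by
      rw [sum_range_natCast_zmod]
      simp only [hg, Finset.sum_sub_distrib, ← Finset.mul_sum, hsumS, hsumC]
      ring
    have hjm := ZMod.val_lt j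
    rcases le_total (P j) Real.pi with hP | hP
    · rw [hug]
      refine Finset.sum_nonneg fun i hi => mul_nonneg (hpos _).le ?_
      rw [Finset.mem_range] at hi
      have hiv : (i : ZMod m).val = i := ZMod.val_cast_of_lt (hi.trans hjm)
      have h1 : P i ≤ P j := cyclicPrefix_mono hα0 (by omega)
      have h2 : 0 ≤ P i := cyclicPrefix_nonneg hα0 _
      exact Real.sin_nonneg_of_nonneg_of_le_pi (by linarith) (by linarith)
    · rw [← Finset.sum_range_add_sum_Ico _ hjm.le, ← hug] at hgm
      have : ∑ i ∈ Finset.Ico j.val m, g (i : ZMod m) ≤ 0 := by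
        refine Finset.sum_nonpos fun i hi => mul_nonpos_of_nonneg_of_nonpos (hpos _).le ?_
        rw [Finset.mem_Ico] at hi
        have hiv : (i : ZMod m).val = i := ZMod.val_cast_of_lt hi.2
        have h1 : P j ≤ P i := cyclicPrefix_mono hα0 (by omega)
        have h2 : P i ≤ 2 * Real.pi := hsum ▸ cyclicPrefix_le_sum hα0 _
        exact Real.sin_nonpos_of_nonpos_of_neg_pi_le (by linarith) (by linarith)
      linarith
  have h01 : u 1 = ℓ 0 * Real.sin (α 0) := by
    have := hnext 0
    rw [zero_add] at this
    rw [this, hX, hY, cyclicPrefix_zero, cyclicPrefix_zero]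
    ring
  calc 0 < u 1 * ℓ 1 := by
        rw [h01]
        exact mul_pos (mul_pos (hpos 0) (hsin 0)) (hpos 1)
    _ ≤ ∑ j, u j * ℓ j :=
        Finset.single_le_sum (f := fun j => u j * ℓ j)
          (fun j _ => mul_nonneg (hu0 j) (hpos j).le) (Finset.mem_univ 1)
    _ = ∑ j, h j * edgeLength α u j := sum_mul_edgeLength_comm α h u
    _ = _ := by simp only [hqu]

end Definiteness

section SphericalTriangle

/-- The angle between the sides `a` and `c` of a spherical triangle in which the sides `a` and
`b` enclose the angle `θ`. -/
theorem cos_sAng_and_sin_sAng {a b c θ : ℝ} (ha : 0 < Real.sin a) (hb : 0 < Real.sin b)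
    (hc : 0 < Real.sin c) (hθ : 0 < Real.sin θ)
    (hcos : Real.cos c = Real.cos a * Real.cos b + Real.sin a * Real.sin b * Real.cos θ) :
    Real.cos (sAng b a c) =
        (Real.sin a * Real.cos b - Real.cos a * Real.sin b * Real.cos θ) / Real.sin c ∧
      Real.sin (sAng b a c) = Real.sin b * Real.sin θ / Real.sin c := by
  set N := Real.sin a * Real.cos b - Real.cos a * Real.sin b * Real.cos θ with hN
  have hsa := Real.sin_sq_add_cos_sq a
  have hsb := Real.sin_sq_add_cos_sq b
  have hsc := Real.sin_sq_add_cos_sq c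
  have hsθ := Real.sin_sq_add_cos_sq θ
  have hX : (Real.cos b - Real.cos a * Real.cos c) / (Real.sin a * Real.sin c) =
      N / Real.sin c := by
    rw [hcos, div_eq_div_iff (mul_pos ha hc).ne' hc.ne', hN]
    linear_combination -Real.cos b * Real.sin c * hsa
  have hsq : N ^ 2 + (Real.sin b * Real.sin θ) ^ 2 = Real.sin c ^ 2 := by
    have h1 : Real.sin c ^ 2 = 1 - (Real.cos a * Real.cos b +
        Real.sin a * Real.sin b * Real.cos θ) ^ 2 := by rw [← hcos]; linarith
    rw [h1, hN]
    have hsa' : Real.sin a ^ 2 = 1 - Real.cos a ^ 2 := by linarith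
    have hsb' : Real.sin b ^ 2 = 1 - Real.cos b ^ 2 := by linarith
    have hsθ' : Real.sin θ ^ 2 = 1 - Real.cos θ ^ 2 := by linarith
    ring_nf
    rw [hsa', hsb', hsθ']
    ring
  have hone : (N / Real.sin c) ^ 2 + (Real.sin b * Real.sin θ / Real.sin c) ^ 2 = 1 := by
    rw [div_pow, div_pow, ← add_div, hsq, div_self (pow_pos hc 2).ne']
  have habs := abs_le.1 (abs_le_one_iff_mul_self_le_one.2
    (by nlinarith [sq_nonneg (Real.sin b * Real.sin θ / Real.sin c)] :
      N / Real.sin c * (N / Real.sin c) ≤ 1))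
  rw [sAng, hX]
  refine ⟨Real.cos_arccos habs.1 habs.2, ?_⟩
  rw [Real.sin_arccos, ← hone, add_sub_cancel_left, Real.sqrt_sq (by positivity)]

theorem cot_sAng {a b c θ : ℝ} (ha : 0 < Real.sin a) (hb : 0 < Real.sin b)
    (hc : 0 < Real.sin c) (hθ : 0 < Real.sin θ)
    (hcos : Real.cos c = Real.cos a * Real.cos b + Real.sin a * Real.sin b * Real.cos θ) :
    0 < Real.sin (sAng b a c) ∧ Real.cos (sAng b a c) = Real.sin (sAng b a c) *
      (Real.sin a * ((Real.cos b / Real.sin b - Real.cos θ * (Real.cos a / Real.sin a)) /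
        Real.sin θ)) := by
  obtain ⟨h1, h2⟩ := cos_sAng_and_sin_sAng ha hb hc hθ hcos
  rw [h1, h2]
  refine ⟨by positivity, ?_⟩
  field_simp

theorem edgeLength_cot_pos {m : ℕ} {ρ α c : ZMod m → ℝ} (hρ : ∀ j, 0 < Real.sin (ρ j))
    (hα : ∀ j, 0 < Real.sin (α j)) (hc : ∀ j, 0 < Real.sin (c j))
    (hcos : ∀ j, Real.cos (c j) =
      Real.cos (ρ j) * Real.cos (ρ (j + 1)) +
        Real.sin (ρ j) * Real.sin (ρ (j + 1)) * Real.cos (α j))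
    {j : ZMod m}
    (hconvex : sAng (ρ (j + 1)) (ρ j) (c j) + sAng (ρ (j - 1)) (ρ j) (c (j - 1)) < Real.pi) :
    0 < edgeLength α (fun k => Real.cos (ρ k) / Real.sin (ρ k)) j := by
  obtain ⟨h1, h2⟩ := cot_sAng (hρ j) (hρ (j + 1)) (hc j) (hα j) (hcos j)
  have hcos' := hcos (j - 1)
  rw [sub_add_cancel] at hcos'
  obtain ⟨h3, h4⟩ := cot_sAng (hρ j) (hρ (j - 1)) (hc (j - 1)) (hα (j - 1))
    (by rw [hcos']; ring)
  have hβ : 0 ≤ sAng (ρ (j + 1)) (ρ j) (c j) := Real.arccos_nonneg _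
  have hγ : 0 ≤ sAng (ρ (j - 1)) (ρ j) (c (j - 1)) := Real.arccos_nonneg _
  have hβ0 : sAng (ρ (j + 1)) (ρ j) (c j) ≠ 0 := fun h => by
    rw [h, Real.sin_zero] at h1; exact h1.false
  have hs := Real.sin_pos_of_pos_of_lt_pi
    (add_pos_of_pos_of_nonneg (hβ.lt_of_ne' hβ0) hγ) hconvex
  rw [Real.sin_add, h2, h4] at hs
  refine pos_of_mul_pos_right (a := Real.sin (sAng (ρ (j + 1)) (ρ j) (c j)) *
    Real.sin (sAng (ρ (j - 1)) (ρ j) (c (j - 1))) * Real.sin (ρ j)) ?_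
    (mul_pos (mul_pos h1 h3) (hρ j)).le
  rw [edgeLength]
  linarith

end SphericalTriangle

section Signature

theorem Matrix.IsHermitian.dotProduct_mulVec_eq_sum {n : Type*} [Fintype n] [DecidableEq n]
    {A : Matrix n n ℝ} (hA : A.IsHermitian) (x : n → ℝ) :
    x ⬝ᵥ A.mulVec x =
      ∑ i, hA.eigenvalues i * (x ⬝ᵥ (hA.eigenvectorBasis i).ofLp) ^ 2 := by
  have h := hA.eigenvectorBasis.sum_inner_mul_inner (WithLp.toLp 2 x)
    (WithLp.toLp 2 (A.mulVec x))
  simp only [EuclideanSpace.inner_eq_star_dotProduct, star_trivial] at h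
  rw [dotProduct_comm, ← h]
  refine Finset.sum_congr rfl fun i _ => ?_
  have hAT : A.transpose = A := by simpa [Matrix.IsHermitian] using hA
  have h1 : A.mulVec x ⬝ᵥ (hA.eigenvectorBasis i).ofLp =
      hA.eigenvalues i * (x ⬝ᵥ (hA.eigenvectorBasis i).ofLp) := by
    rw [dotProduct_comm, Matrix.dotProduct_mulVec, ← Matrix.mulVec_transpose, hAT,
      hA.mulVec_eigenvectorBasis, smul_dotProduct, smul_eq_mul, dotProduct_comm]
  rw [h1, dotProduct_comm]
  ring

/-- A symmetric matrix which is nonpositive on a hyperplane and positive somewhere has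
exactly one positive eigenvalue. -/
theorem Matrix.IsHermitian.card_pos_eigenvalues_eq_one {n : Type*} [Fintype n] [DecidableEq n]
    {A : Matrix n n ℝ} (hA : A.IsHermitian) {x : n → ℝ} (hx : 0 < x ⬝ᵥ A.mulVec x)
    (φ : (n → ℝ) →ₗ[ℝ] ℝ) (hφ : ∀ y, φ y = 0 → y ⬝ᵥ A.mulVec y ≤ 0) :
    (Finset.univ.filter fun j => 0 < hA.eigenvalues j).card = 1 := by
  obtain ⟨i, hi⟩ : ∃ i, 0 < hA.eigenvalues i := by
    by_contra! h
    rw [hA.dotProduct_mulVec_eq_sum] at hx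
    exact hx.not_ge (Finset.sum_nonpos fun i _ =>
      mul_nonpos_of_nonpos_of_nonneg (h i) (sq_nonneg _))
  rw [Finset.card_eq_one]
  refine ⟨i, Finset.eq_singleton_iff_unique_mem.2 ⟨by simpa using hi, fun j hj => ?_⟩⟩
  have hj : 0 < hA.eigenvalues j := by simpa using hj
  by_contra hji
  let b : n → n → ℝ := fun k => (hA.eigenvectorBasis k).ofLp
  have hb : ∀ k l, b k ⬝ᵥ b l = if l = k then 1 else 0 := by
    intro k l
    have := orthonormal_iff_ite.1 hA.eigenvectorBasis.orthonormal l k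
    rwa [EuclideanSpace.inner_eq_star_dotProduct, star_trivial] at this
  have hcomb : ∀ p r : ℝ, (p • b i + r • b j) ⬝ᵥ A.mulVec (p • b i + r • b j) =
      hA.eigenvalues i * p ^ 2 + hA.eigenvalues j * r ^ 2 := by
    intro p r
    have hm : ∀ k, A.mulVec (b k) = hA.eigenvalues k • b k := hA.mulVec_eigenvectorBasis
    simp only [Matrix.mulVec_add, Matrix.mulVec_smul, hm, dotProduct_add, add_dotProduct,
      smul_dotProduct, dotProduct_smul, hb, smul_eq_mul, hji, Ne.symm hji, if_true, if_false]
    ring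
  by_cases h : φ (b i) = 0
  · have := hφ ((1 : ℝ) • b i + (0 : ℝ) • b j) (by simp [h])
    rw [hcomb] at this
    linarith
  · have := hφ (φ (b j) • b i + (-φ (b i)) • b j) (by simp; ring)
    rw [hcomb] at this
    have h2 : 0 < φ (b i) ^ 2 := by positivity
    nlinarith [mul_pos hj h2, mul_nonneg hi.le (sq_nonneg (φ (b j)))]

theorem Matrix.IsHermitian.card_zero_eigenvalues {n : Type*} [Fintype n] [DecidableEq n]
    {A : Matrix n n ℝ} (hA : A.IsHermitian) :
    (Finset.univ.filter fun j => hA.eigenvalues j = 0).card =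
      Module.finrank ℝ (LinearMap.ker A.mulVecLin) := by
  have h1 := hA.rank_eq_card_non_zero_eigs
  have h2 := LinearMap.finrank_range_add_finrank_ker A.mulVecLin
  rw [Fintype.card_subtype] at h1
  have h3 := Finset.card_filter_add_card_filter_not (s := (Finset.univ : Finset n))
    (fun j => hA.eigenvalues j = 0)
  rw [Module.finrank_fintype_fun_eq_card] at h2
  rw [Finset.card_univ] at h3
  rw [Matrix.rank] at h1
  simp only [ne_eq] at h1
  omega

end Signature

section Kernel

variable {m : ℕ} [NeZero m]

theorem eq_zero_of_edgeLength_eq_zero {α u : ZMod m → ℝ} (hα : ∀ j, 0 < Real.sin (α j))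
    (hu : ∀ j, edgeLength α u j = 0) (h0 : u 0 = 0) (h1 : u 1 = 0) : u = 0 := by
  have h : ∀ n : ℕ, u n = 0 ∧ u (n + 1 : ℕ) = 0 := by
    intro n
    induction n with
    | zero => simpa using ⟨h0, h1⟩
    | succ n ih =>
      refine ⟨ih.2, ?_⟩
      have h2 := hu (n + 1 : ℕ)
      have h3 : ((n + 1 : ℕ) : ZMod m) - 1 = n := by simp
      rw [edgeLength, h3, ih.1, ih.2] at h2
      have h4 := (hα (n + 1 : ℕ)).ne'
      push_cast at h2 h4 ⊢
      simpa [h4] using h2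
  funext j
  rw [← ZMod.natCast_zmod_val j]
  exact (h _).1

theorem finrank_ker_of_edgeLength {α : ZMod m → ℝ} (hα : ∀ j, 0 < Real.sin (α j))
    (hsum : ∑ j, α j = 2 * Real.pi) {r : ZMod m → ℝ} (hr : ∀ j, r j ≠ 0)
    (K : Submodule ℝ (ZMod m → ℝ))
    (hK : ∀ s, s ∈ K ↔ ∀ j, edgeLength α (fun k => s k / r k) j = 0) :
    Module.finrank ℝ K = 2 := by
  let f : K →ₗ[ℝ] ℝ × ℝ :=
    ((LinearMap.proj 0).prod (LinearMap.proj 1)).comp K.subtype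
  have hinj : Function.Injective f := by
    rw [← LinearMap.ker_eq_bot, LinearMap.ker_eq_bot']
    rintro ⟨s, hs⟩ hfs
    have h01 : s 0 = 0 ∧ s 1 = 0 := Prod.mk.inj hfs
    have := eq_zero_of_edgeLength_eq_zero hα ((hK s).1 hs) (by simp [h01.1]) (by simp [h01.2])
    ext j
    have hj := congrFun this j
    simpa [hr j] using hj
  have hsurj : Function.Surjective f := by
    rintro ⟨x, y⟩
    let a := x / r 0
    let b := (y / r 1 - Real.cos (α 0) * a) / Real.sin (α 0)
    let v := a • normalCos α + b • normalSin α
    have hv : ∀ j, edgeLength α v j = 0 := fun j => by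
      simp only [v]
      rw [edgeLength_add_smul, edgeLength_normalCos hα hsum, edgeLength_normalSin hα hsum]
      ring
    refine ⟨⟨fun k => v k * r k, (hK _).2 fun j => ?_⟩, ?_⟩
    · simp only [mul_div_cancel_right₀ _ (hr _)]
      exact hv j
    · have hs := (hα 0).ne'
      have hS : normalSin α 1 = Real.sin (α 0) := by
        have := normalSin_add_one hsum 0
        rwa [normalSin_zero, normalCos_zero, zero_add, zero_mul, zero_add, one_mul] at this
      have hC : normalCos α 1 = Real.cos (α 0) := by
        have := normalCos_add_one hsum 0
        rwa [normalSin_zero, normalCos_zero, zero_add, zero_mul, sub_zero, one_mul] at this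
      refine Prod.ext ?_ ?_
      · change v 0 * r 0 = x
        simp only [v, a, Pi.add_apply, Pi.smul_apply, smul_eq_mul, normalSin_zero,
          normalCos_zero]
        have := hr 0
        field_simp
        ring
      · change v 1 * r 1 = y
        simp only [v, b, Pi.add_apply, Pi.smul_apply, smul_eq_mul, hS, hC]
        have := hr 1
        field_simp
        ring
  rw [(LinearEquiv.ofBijective f ⟨hinj, hsurj⟩).finrank_eq, Module.finrank_prod,
    Module.finrank_self]

/-- The curvature Hessian acts on `s` through the edge lengths of the planar polygon with
support numbers `s / sin ρ`. -/
theorem curvature_hessian_mulVec (hm : 3 ≤ m) {ρ α : ZMod m → ℝ}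
    (hρ : ∀ j, 0 < Real.sin (ρ j)) (hα : ∀ j, 0 < Real.sin (α j))
    {L : Matrix (ZMod m) (ZMod m) ℝ}
    (hL : ∀ j k, L j k =
      if k = j then -(Real.cot (α (j - 1)) + Real.cot (α j)) / Real.sin (ρ j) ^ 2
      else if k = j + 1 then
        1 / (Real.sin (α j) * Real.sin (ρ j) * Real.sin (ρ (j + 1)))
      else if j = k + 1 then
        1 / (Real.sin (α k) * Real.sin (ρ k) * Real.sin (ρ (k + 1)))
      else 0) (s : ZMod m → ℝ) (j : ZMod m) :
    L.mulVec s j = edgeLength α (fun k => s k / Real.sin (ρ k)) j / Real.sin (ρ j) := by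
  have hone : (1 : ZMod m) ≠ 0 := fun h => by
    have := (ZMod.natCast_eq_zero_iff 1 m).1 (by simpa using h)
    have := Nat.le_of_dvd one_pos this
    omega
  have htwo : (2 : ZMod m) ≠ 0 := fun h => by
    have := (ZMod.natCast_eq_zero_iff 2 m).1 (by simpa using h)
    have := Nat.le_of_dvd two_pos this
    omega
  have h1 : j + 1 ≠ j := fun h => hone (by linear_combination h)
  have h2 : j - 1 ≠ j := fun h => hone (by linear_combination -h)
  have h3 : j - 1 ≠ j + 1 := fun h => htwo (by linear_combination -h)
  have hsplit : ∀ k, L j k * s k =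
      (if k = j then L j j * s j else 0) + (if k = j + 1 then L j (j + 1) * s (j + 1) else 0) +
        (if k = j - 1 then L j (j - 1) * s (j - 1) else 0) := by
    intro k
    by_cases hk1 : k = j
    · subst hk1; simp [h1.symm, h2.symm]
    by_cases hk2 : k = j + 1
    · subst hk2; simp [h1, h3.symm]
    by_cases hk3 : k = j - 1
    · subst hk3; simp [h2, h3]
    have hk4 : j ≠ k + 1 := fun h => hk3 (by rw [h]; ring)
    rw [hL]
    simp [hk1, hk2, hk3, hk4]
  have hexp : L.mulVec s j = L j j * s j + L j (j + 1) * s (j + 1) + L j (j - 1) * s (j - 1) := by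
    rw [Matrix.mulVec, dotProduct, Finset.sum_congr rfl fun k _ => hsplit k]
    simp [Finset.sum_add_distrib]
  rw [hexp, hL, hL, hL, if_pos rfl, if_neg h1, if_pos rfl, if_neg h2, if_neg h3,
    if_pos (sub_add_cancel j 1).symm, sub_add_cancel, edgeLength, Real.cot_eq_cos_div_sin,
    Real.cot_eq_cos_div_sin]
  have := (hρ j).ne'
  have := (hρ (j + 1)).ne'
  have := (hρ (j - 1)).ne'
  have := (hα j).ne'
  have := (hα (j - 1)).ne'
  field_simp
  ring

end Kernel

/-- The second differential `L = (∂λⱼ/∂s_k)` of the total curvature of a warped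
spherical polygon (at a convex spherical `m`-gon with a marked interior point, i.e. with
zero cone angle defect) has signature `(+₁, 0₂, −_{m−3})`, and is positive on the vector
`s = (cos ρⱼ)ⱼ`. -/
theorem warped_polygon_curvature_hessian_signature
    (m : ℕ) [NeZero m] (hm : 3 ≤ m)
    (ρ α : ZMod m → ℝ)
    (hρ : ∀ j, 0 < ρ j ∧ ρ j < Real.pi)
    (hα : ∀ j, 0 < α j ∧ α j < Real.pi)
    (hsum : ∑ j, α j = 2 * Real.pi)
    (c : ZMod m → ℝ) (hc : ∀ j, 0 < c j ∧ c j < Real.pi)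
    (hcos : ∀ j, Real.cos (c j) =
      Real.cos (ρ j) * Real.cos (ρ (j + 1)) +
        Real.sin (ρ j) * Real.sin (ρ (j + 1)) * Real.cos (α j))
    (hconvex : ∀ j,
      sAng (ρ (j + 1)) (ρ j) (c j) + sAng (ρ (j - 1)) (ρ j) (c (j - 1)) < Real.pi)
    (L : Matrix (ZMod m) (ZMod m) ℝ)
    (hL : ∀ j k, L j k =
      if k = j then -(Real.cot (α (j - 1)) + Real.cot (α j)) / Real.sin (ρ j) ^ 2
      else if k = j + 1 then
        1 / (Real.sin (α j) * Real.sin (ρ j) * Real.sin (ρ (j + 1)))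
      else if j = k + 1 then
        1 / (Real.sin (α k) * Real.sin (ρ k) * Real.sin (ρ (k + 1)))
      else 0)
    (hHerm : L.IsHermitian) :
    ((Finset.univ.filter fun j : ZMod m => 0 < hHerm.eigenvalues j).card = 1 ∧
      (Finset.univ.filter fun j : ZMod m => hHerm.eigenvalues j = 0).card = 2 ∧
      (Finset.univ.filter fun j : ZMod m => hHerm.eigenvalues j < 0).card = m - 3) ∧
    0 < (fun k => Real.cos (ρ k)) ⬝ᵥ L.mulVec (fun k => Real.cos (ρ k)) := by
  have hsρ : ∀ j, 0 < Real.sin (ρ j) := fun j =>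
    Real.sin_pos_of_pos_of_lt_pi (hρ j).1 (hρ j).2
  have hsα : ∀ j, 0 < Real.sin (α j) := fun j =>
    Real.sin_pos_of_pos_of_lt_pi (hα j).1 (hα j).2
  have hsc : ∀ j, 0 < Real.sin (c j) := fun j =>
    Real.sin_pos_of_pos_of_lt_pi (hc j).1 (hc j).2
  have hmul := curvature_hessian_mulVec hm hsρ hsα hL
  have hform : ∀ s : ZMod m → ℝ, s ⬝ᵥ L.mulVec s =
      ∑ j, s j / Real.sin (ρ j) * edgeLength α (fun k => s k / Real.sin (ρ k)) j := by
    intro s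
    refine Finset.sum_congr rfl fun j _ => ?_
    rw [hmul]
    ring
  have hpos : 0 < (fun k => Real.cos (ρ k)) ⬝ᵥ L.mulVec (fun k => Real.cos (ρ k)) := by
    rw [hform]
    exact sum_mul_edgeLength_pos hα hsum fun j =>
      edgeLength_cot_pos hsρ hsα hsc hcos (hconvex j)
  have hone : (Finset.univ.filter fun j : ZMod m => 0 < hHerm.eigenvalues j).card = 1 := by
    obtain ⟨φ, hφ⟩ := exists_hyperplane_nonpos hα hsum
    refine hHerm.card_pos_eigenvalues_eq_one hpos
      (φ ∘ₗ LinearMap.pi fun k => (Real.sin (ρ k))⁻¹ • LinearMap.proj k) fun s hs => ?_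
    rw [hform]
    refine hφ _ ?_
    rw [← hs]
    refine congrArg φ (funext fun k => ?_)
    simp [div_eq_inv_mul]
  have hzero : (Finset.univ.filter fun j : ZMod m => hHerm.eigenvalues j = 0).card = 2 := by
    rw [hHerm.card_zero_eigenvalues]
    refine finrank_ker_of_edgeLength hsα hsum (fun j => (hsρ j).ne') _ fun s => ?_
    rw [LinearMap.mem_ker, Matrix.mulVecLin_apply, funext_iff]
    refine forall_congr' fun j => ?_
    rw [hmul, Pi.zero_apply, div_eq_zero_iff, or_iff_left (hsρ j).ne']
  refine ⟨⟨hone, hzero, ?_⟩, hpos⟩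
  have hsplit : (Finset.univ : Finset (ZMod m)) =
      (Finset.univ.filter fun j => 0 < hHerm.eigenvalues j) ∪
        ((Finset.univ.filter fun j => hHerm.eigenvalues j = 0) ∪
          Finset.univ.filter fun j => hHerm.eigenvalues j < 0) := by
    ext j
    simp only [Finset.mem_univ, Finset.mem_union, Finset.mem_filter, true_and, true_iff]
    rcases lt_trichotomy (hHerm.eigenvalues j) 0 with h | h | h <;> simp [h]
  have hcard := congrArg Finset.card hsplit
  rw [Finset.card_univ, ZMod.card, Finset.card_union_of_disjoint, Finset.card_union_of_disjoint,
    hone, hzero] at hcard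
  · omega
  · exact Finset.disjoint_filter.2 fun j _ h1 h2 => h2.ne h1
  · rw [Finset.disjoint_union_right]
    exact ⟨Finset.disjoint_filter.2 fun j _ h1 h2 => h1.ne' h2,
      Finset.disjoint_filter.2 fun j _ h1 h2 => h1.not_gt h2⟩
end
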